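/- arXiv:math/0203203 — 2 statements merged into one kernel-verified Lean document; each statement's English description precedes it below -/
import Mathlib

section
/- Let A ⊆ ℝP^n be an L-convex-concave set with dim L = n − 2. The hyperplanes of ℝP^n containing L are parameterized by the points of the projective line ℝP^n/L via the projection π_L from center L: for c ∈ ℝP^n/L let Γ_c := π_L^{-1}(c) ∪ L. Let a ≠ b be points of ℝP^n/L, let [a,b] be one of the two closed arcs of the projective line ℝP^n/L with endpoints a and b, and fix c ∈ ℝP^n/L ∖ [a,b]. Define S_{[a,b]}(A) ⊆ ℝP^n by: S_{[a,b]}(A) ∩ L = ∅; for x ∉ L with π_L(x) ∈ [a,b], x ∈ S_{[a,b]}(A) if and only if x belongs to the convex hull of (A ∩ Γ_a) ∪ (A ∩ Γ_b) taken in the affine chart ℝP^n ∖ Γ_c; for x ∉ L with π_L(x) ∉ [a,b], x ∈ S_{[a,b]}(A) if and only if x ∈ A. Then S_{[a,b]}(A) does not depend on the choice of c, and S_{[a,b]}(A) is L-convex-concave. -/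
open Module Set Pointwise

noncomputable section

namespace CC

/-- The underlying vector space of `ℝPⁿ`. -/
abbrev Vec (n : ℕ) : Type := Fin (n + 1) → ℝ

/-- Real projective `n`-space `ℝPⁿ = ℙ(ℝ^{n+1})`. -/
abbrev Pt (n : ℕ) : Type := Projectivization ℝ (Vec n)

/-- The dual projective space `(ℝPⁿ)*`, whose points are the hyperplanes of `ℝPⁿ`. -/
abbrev DPt (n : ℕ) : Type := Projectivization ℝ (Module.Dual ℝ (Vec n))

/-- The quotient topology on a projectivization. -/
instance projTop {K V : Type*} [DivisionRing K] [AddCommGroup V] [Module K V]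
    [TopologicalSpace V] : TopologicalSpace (Projectivization K V) :=
  instTopologicalSpaceQuotient

/-- The canonical topology on the dual of `ℝ^{n+1}` (transported through any linear
coordinate system; all bases induce the same topology). -/
instance dualTop (n : ℕ) : TopologicalSpace (Module.Dual ℝ (Vec n)) :=
  TopologicalSpace.induced (Module.finBasis ℝ (Module.Dual ℝ (Vec n))).equivFun inferInstance

variable {M : Type*} [AddCommGroup M] [Module ℝ M]

/-- The point `x ∈ ℙ(M)` lies on the hyperplane corresponding to the point `π` of the
dual projective space `ℙ(M*)` (i.e. `x` is in the projectivization of the kernel of any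
functional representing `π`). -/
def Incident (π : Projectivization ℝ (Module.Dual ℝ M)) (x : Projectivization ℝ M) : Prop :=
  π.rep x.rep = 0

/-- The projectively dual set `S*_p ⊆ P*`: the set of all hyperplanes of `P`
disjoint from `S`. -/
def dualSet (A : Set (Projectivization ℝ M)) : Set (Projectivization ℝ (Module.Dual ℝ M)) :=
  {π | ∀ x ∈ A, ¬Incident π x}

/-- Projective separability: every point of the complement of `S` lies on a hyperplane
disjoint from `S`. -/
def ProjSeparable (A : Set (Projectivization ℝ M)) : Prop :=
  ∀ x ∉ A, ∃ π : Projectivization ℝ (Module.Dual ℝ M), Incident π x ∧ ∀ y ∈ A, ¬Incident π y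

/-- The projective subspace of `ℙ(M)` associated to a linear subspace `W ≤ M`. -/
def projSet (W : Submodule ℝ M) : Set (Projectivization ℝ M) :=
  {x | x.rep ∈ W}

/-- The canonical identification `ℙ(M) → ℙ(M**)` induced by the canonical isomorphism
`M ≃ M**`. -/
def toDoubleDual [FiniteDimensional ℝ M] :
    Projectivization ℝ M → Projectivization ℝ (Module.Dual ℝ (Module.Dual ℝ M)) :=
  Projectivization.map (Module.evalEquiv ℝ M).toLinearMap (Module.evalEquiv ℝ M).injective

/-- The `L`-dual set `A^⊥_L ⊆ ℙ(M*)` of a set `A ⊆ ℙ(M)` (for `L = ℙ(W)`): the set of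
all hyperplanes `π` of `ℙ(M)` meeting every section `A ∩ N` by a projective subspace
`N ⊇ L` with `dim N = dim L + 1`. -/
def LdualSet (W : Submodule ℝ M) (A : Set (Projectivization ℝ M)) :
    Set (Projectivization ℝ (Module.Dual ℝ M)) :=
  {π | ∀ N : Submodule ℝ M, W ≤ N → finrank ℝ N = finrank ℝ W + 1 →
    ∃ x ∈ A, Incident π x ∧ x.rep ∈ N}

/-- `(A^⊥_L)^⊥_{L*}`, brought back from `ℙ(M**)` to `ℙ(M)` via the canonical
identification `M ≅ M**`. -/
def Lbidual [FiniteDimensional ℝ M] (W : Submodule ℝ M) (A : Set (Projectivization ℝ M)) :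
    Set (Projectivization ℝ M) :=
  toDoubleDual ⁻¹' LdualSet W.dualAnnihilator (LdualSet W A)

/-- The image of a set `A ⊆ ℙ(M)` under the projection from the center `ℙ(W)`:
`y` is in the image iff some point `x ∈ A` not in the center projects to `y`
(i.e. the class of a representing vector of `x` spans the line `y`). -/
def projImage (W : Submodule ℝ M) (A : Set (Projectivization ℝ M)) :
    Set (Projectivization ℝ (M ⧸ W)) :=
  {y | ∃ x ∈ A, x.rep ∉ W ∧ W.mkQ x.rep ∈ y.submodule}

/-- The coordinate, in the affine chart of `ℙ(M)` given by a functional `φ`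
(the complement of the hyperplane `ℙ(ker φ)`, identified with `{v | φ v = 1}`),
of a point `x` with `φ x.rep ≠ 0`. -/
def projChart (φ : Module.Dual ℝ M) (x : Projectivization ℝ M) : M :=
  (φ x.rep)⁻¹ • x.rep

/-- A convex subset of a projective space: a set disjoint from some hyperplane and
convex in the corresponding affine chart. -/
def IsProjConvex (A : Set (Projectivization ℝ M)) : Prop :=
  ∃ φ : Module.Dual ℝ M, φ ≠ 0 ∧ (∀ x ∈ A, φ x.rep ≠ 0) ∧ Convex ℝ (projChart φ '' A)

/-- `L`-convex-concavity of a closed set `A ⊆ ℙ(M)` with respect to the projective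
subspace `L = ℙ(W)`: `A` is closed, disjoint from `L`, all sections of `A` by
projective subspaces `N ⊇ L` with `dim N = dim L + 1` are nonempty and convex, and the
complement of the projection of `A` from any center `T ⊂ L` with `dim T = dim L − 1`
is open and convex. -/
def IsLConvexConcave [TopologicalSpace M] (W : Submodule ℝ M)
    (A : Set (Projectivization ℝ M)) : Prop :=
  IsClosed A ∧ (∀ x ∈ A, x.rep ∉ W) ∧
    (∀ N : Submodule ℝ M, W ≤ N → finrank ℝ N = finrank ℝ W + 1 →
      (A ∩ projSet N).Nonempty ∧ IsProjConvex (A ∩ projSet N)) ∧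
    (∀ T : Submodule ℝ M, T ≤ W → finrank ℝ T + 1 = finrank ℝ W →
      IsOpen (projImage T A)ᶜ ∧ IsProjConvex (projImage T A)ᶜ)

/-- The lift of a hyperplane `π` of `ℙ(M)` containing the center `ℙ(Q)` to a hyperplane
of the quotient projective space `ℙ(M ⧸ Q)`. -/
def liftHyperplane (Q : Submodule ℝ M) (π : Projectivization ℝ (Module.Dual ℝ M))
    (h : ∀ v ∈ Q, π.rep v = 0) : Projectivization ℝ (Module.Dual ℝ (M ⧸ Q)) :=
  Projectivization.mk ℝ (Q.liftQ π.rep fun v hv => LinearMap.mem_ker.mpr (h v hv))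
    (fun hz => π.rep_nonzero (by
      have h2 := Submodule.liftQ_mkQ Q π.rep (fun v hv => LinearMap.mem_ker.mpr (h v hv))
      rw [hz] at h2
      simpa using h2.symm))

/-- Affine separability of a set `B`, inside the affine chart of `ℙ(M)` given by a
functional `φ`: every point of the chart outside `B` lies in a closed half-space of the
chart (cut out by an affine function which is nonconstant on the chart) disjoint
from `B`.  A closed half-space of the chart `{v | φ v = 1}` is cut out by a functional
`g` (nonproportional to `φ`, so that `g` is nonconstant on the chart) via the
scale-invariant condition `g(x)/φ(x) ≥ 0`. -/
def AffSepInChart (φ : Module.Dual ℝ M) (B : Set (Projectivization ℝ M)) : Prop :=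
  ∀ y : Projectivization ℝ M, φ y.rep ≠ 0 → y ∉ B →
    ∃ g : Module.Dual ℝ M, (∀ c : ℝ, g ≠ c • φ) ∧ 0 ≤ g y.rep / φ y.rep ∧
      ∀ z ∈ B, g z.rep / φ z.rep < 0

/-- `A` is coseparable relative to `L = ℙ(W)`: `A` is disjoint from `L`, and for every
hyperplane `L₁` of `L`, the complement of the projection of `A` from the center `L₁`
misses some hyperplane of `ℝPⁿ/L₁` and is affinely separable in the corresponding
affine chart. -/
def Coseparable (W : Submodule ℝ M) (A : Set (Projectivization ℝ M)) : Prop :=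
  (∀ x ∈ A, x.rep ∉ W) ∧
    ∀ W₁ : Submodule ℝ M, W₁ ≤ W → finrank ℝ W₁ + 1 = finrank ℝ W →
      ∃ φ : Module.Dual ℝ (M ⧸ W₁), φ ≠ 0 ∧
        (∀ y ∈ (projImage W₁ A)ᶜ, φ y.rep ≠ 0) ∧
        AffSepInChart φ (projImage W₁ A)ᶜ

/-- A set `S` contained in the projective subspace `N = ℙ(Nsub)`, disjoint from the
hyperplane `L = ℙ(W)` of `N`, is pointed with respect to `Δ ⊆ L` if it has two vertices
`a, b ∈ S` such that a hyperplane `p` of `N` disjoint from `Δ` meets `S` iff it meets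
the straight segment joining `a` and `b` in the affine chart `N ∖ L` (the chart being
given by any functional vanishing on `W` and nonzero at `a` and `b`). -/
def PointedWrt (W Nsub : Submodule ℝ M) (Δ S : Set (Projectivization ℝ M)) : Prop :=
  ∃ a ∈ S, ∃ b ∈ S,
    ∀ P : Submodule ℝ M, P ≤ Nsub → finrank ℝ P + 1 = finrank ℝ Nsub →
      (∀ x ∈ Δ, x.rep ∉ P) →
      ((∃ x ∈ S, x.rep ∈ P) ↔
        ∀ φ : Module.Dual ℝ M, (∀ w ∈ W, φ w = 0) → φ a.rep ≠ 0 → φ b.rep ≠ 0 →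
          ∃ t ∈ Icc (0 : ℝ) 1,
            t • ((φ a.rep)⁻¹ • a.rep) + (1 - t) • ((φ b.rep)⁻¹ • b.rep) ∈ P)

/-- The hyperplane `Γ_c` of `ℙ(M)` containing the center `ℙ(W)` and corresponding to the
point `c` of `ℙ(M ⧸ W)`. -/
def gammaSet (W : Submodule ℝ M) (c : Projectivization ℝ (M ⧸ W)) :
    Set (Projectivization ℝ M) :=
  {x | W.mkQ x.rep ∈ c.submodule}

/-- The surgery `S_{[a,b]}(A)` of a set `A ⊆ ℙ(M)` along the arc `Arc = [a,b]` of the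
projective line `ℙ(M ⧸ W)`, computed in the affine chart given by a functional `φ`
whose kernel is the cone of the hyperplane `Γ_c` (for a point `c ∉ Arc`): points
projecting into `Arc` are replaced by the convex hull of `(A ∩ Γ_a) ∪ (A ∩ Γ_b)` taken
in the chart, points projecting outside `Arc` are kept iff they belong to `A`, and the
result is disjoint from `ℙ(W)`. -/
def surgery (W : Submodule ℝ M) (a b : Projectivization ℝ (M ⧸ W))
    (Arc : Set (Projectivization ℝ (M ⧸ W))) (φ : Module.Dual ℝ M)
    (A : Set (Projectivization ℝ M)) : Set (Projectivization ℝ M) :=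
  {x | x.rep ∉ W ∧
    ((∃ y ∈ Arc, W.mkQ x.rep ∈ y.submodule) →
      φ x.rep ≠ 0 ∧
        projChart φ x ∈ convexHull ℝ (projChart φ '' (A ∩ (gammaSet W a ∪ gammaSet W b)))) ∧
    ((¬∃ y ∈ Arc, W.mkQ x.rep ∈ y.submodule) → x ∈ A)}

/-- The linear map `M* ⧸ T → Q*` (for `Q = ℙ(T)*`-perp, i.e. `Q = T.dualCoannihilator`)
realizing the canonical identification of `(ℝPⁿ)*/T` with the space of hyperplanes of
the projective space `ℙ(Q)`: the class of a hyperplane `π ⊅ Q` of `ℝPⁿ` corresponds to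
the hyperplane `π ∩ ℙ(Q)` of `ℙ(Q)`. -/
def restrictToSub (T : Submodule ℝ (Module.Dual ℝ M)) :
    (Module.Dual ℝ M ⧸ T) →ₗ[ℝ] Module.Dual ℝ T.dualCoannihilator :=
  T.liftQ (T.dualCoannihilator.subtype.dualMap)
    (fun φ hφ => LinearMap.mem_ker.mpr
      (LinearMap.ext fun q => (Submodule.mem_dualCoannihilator _).mp q.2 φ hφ))


theorem core_side {U : ℝ → ℝ → ℝ → Prop}
    (hadd : ∀ {s s' r x x' y}, U s s' r → U x x' y → U (s + x) (s' + x') (r + y))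
    (hsmul : ∀ {c s s' r : ℝ}, 0 < c → U s s' r → U (c * s) (c * s') (c * r))
    (he : U 0 0 1)
    {t0 t1 : ℝ} (h01 : t0 ≤ t1)
    (hin : ∀ t, t0 ≤ t → t ≤ t1 → ¬U 1 0 t ∧ ¬U (-1) 0 (-t))
    (hout : ∀ t, (t < t0 ∨ t1 < t) → U 1 0 t ∨ U (-1) 0 (-t)) :
    (∀ t, t1 < t → U 1 0 t) ∧ (∀ t, t < t0 → U (-1) 0 (-t)) := by
  have hup : ∀ {s s' r : ℝ} (x : ℝ), 0 < x → U s s' r → U s s' (r + x) := by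
    intro s s' r x hx h
    have := hadd h (hsmul hx he)
    simpa using this
  constructor
  · intro t ht
    rcases hout t (Or.inr ht) with h | h
    · exact h
    · have := hup (t - t1) (by linarith) h
      have h2 := (hin t1 h01 le_rfl).2
      exact absurd (by convert this using 1; ring) h2
  · intro t ht
    rcases hout t (Or.inl ht) with h | h
    · have := hup (t0 - t) (by linarith) h
      have h2 := (hin t0 le_rfl h01).1
      exact absurd (by convert this using 1; ring) h2
    · exact h

theorem core_real {U : ℝ → ℝ → ℝ → Prop}
    (hadd : ∀ {s s' r x x' y}, U s s' r → U x x' y → U (s + x) (s' + x') (r + y))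
    (hsmul : ∀ {c s s' r : ℝ}, 0 < c → U s s' r → U (c * s) (c * s') (c * r))
    (h0 : ¬U 0 0 0) (he : U 0 0 1)
    (hop : ∀ {s s' r}, U s s' r → ∃ δ > 0, U s s' (r - δ))
    {t0 t1 w0 w1 : ℝ} (h01 : t0 ≤ t1) (hw : w0 ≤ w1)
    (ain : ∀ t, t0 ≤ t → t ≤ t1 → ¬U 1 0 t ∧ ¬U (-1) 0 (-t))
    (aout : ∀ t, (t < t0 ∨ t1 < t) → U 1 0 t ∨ U (-1) 0 (-t))
    (bin : ∀ t, w0 ≤ t → t ≤ w1 → ¬U 0 1 t ∧ ¬U 0 (-1) (-t))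
    (bout : ∀ t, (t < w0 ∨ w1 < t) → U 0 1 t ∨ U 0 (-1) (-t))
    (s s' r : ℝ) :
    ¬((s * s' < 0 ∧ ¬U s s' r ∧ ¬U (-s) (-s') (-r)) ∨
      (0 ≤ s ∧ 0 ≤ s' ∧ t0 * s + w0 * s' ≤ r ∧ r ≤ t1 * s + w1 * s') ∨
      (s ≤ 0 ∧ s' ≤ 0 ∧ t1 * s + w1 * s' ≤ r ∧ r ≤ t0 * s + w0 * s')) ↔
    (U s s' r ∧ t0 * s + w0 * s' < r ∧ t1 * s + w1 * s' < r) ∨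
    (U (-s) (-s') (-r) ∧ t0 * (-s) + w0 * (-s') < -r ∧ t1 * (-s) + w1 * (-s') < -r) := by
  obtain ⟨a1, a0⟩ := core_side (U := U) hadd hsmul he h01 ain aout
  obtain ⟨b1, b0⟩ := core_side (U := fun s s' r => U s' s r) (fun h h' => hadd h h')
    (fun h h' => hsmul h h') he hw bin bout
  have hup : ∀ {s s' r : ℝ} (x : ℝ), 0 < x → U s s' r → U s s' (r + x) := by
    intro s s' r x hx h
    have := hadd h (hsmul hx he)
    simpa using this
  have hne : ∀ x : ℝ, U 0 0 x → 0 < x := by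
    intro x hx
    by_contra hcon
    rcases (not_lt.1 hcon).eq_or_lt with h | h
    · exact h0 (h ▸ hx)
    · exact h0 (by simpa using hup (-x) (by linarith) hx)
  -- scaled versions
  have A1 : ∀ c x : ℝ, 0 < c → t1 * c < x → U c 0 x := by
    intro c x hc hx
    have := hsmul hc (a1 (x / c) (by rwa [lt_div_iff₀ hc]))
    simpa [mul_div_cancel₀ _ hc.ne'] using this
  have A0 : ∀ c x : ℝ, c < 0 → t0 * c < x → U c 0 x := by
    intro c x hc hx
    have := hsmul (neg_pos.2 hc) (a0 (x / c) (by rwa [div_lt_iff_of_neg hc]))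
    simpa [mul_div_cancel₀ _ hc.ne] using this
  have B1 : ∀ c x : ℝ, 0 < c → w1 * c < x → U 0 c x := by
    intro c x hc hx
    have := hsmul hc (b1 (x / c) (by rwa [lt_div_iff₀ hc]))
    simpa [mul_div_cancel₀ _ hc.ne'] using this
  have B0 : ∀ c x : ℝ, c < 0 → w0 * c < x → U 0 c x := by
    intro c x hc hx
    have := hsmul (neg_pos.2 hc) (b0 (x / c) (by rwa [div_lt_iff_of_neg hc]))
    simpa [mul_div_cancel₀ _ hc.ne] using this
  have A1' : ∀ c x : ℝ, 0 < c → U c 0 x → t1 * c < x := by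
    intro c x hc h
    by_contra hcon
    rcases (not_lt.1 hcon).eq_or_lt with h' | h'
    · have := hsmul (inv_pos.2 hc) h
      rw [h'] at this
      exact (ain t1 h01 le_rfl).1 (by convert this using 1 <;> field_simp <;> simp)
    · have := hsmul (inv_pos.2 hc) (hup _ (sub_pos.2 h') h)
      exact (ain t1 h01 le_rfl).1 (by convert this using 1 <;> field_simp <;> simp)
  have A0' : ∀ c x : ℝ, c < 0 → U c 0 x → t0 * c < x := by
    intro c x hc h
    by_contra hcon
    have key : U c 0 (t0 * c) := by
      rcases (not_lt.1 hcon).eq_or_lt with h' | h'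
      · rwa [← h']
      · simpa using (hup _ (sub_pos.2 h') h)
    have := hsmul (inv_pos.2 (neg_pos.2 hc)) key
    have hc' := hc.ne
    refine (ain t0 le_rfl h01).2 ?_
    convert this using 1 <;> field_simp <;> simp
  have B1' : ∀ c x : ℝ, 0 < c → U 0 c x → w1 * c < x := by
    intro c x hc h
    by_contra hcon
    have key : U 0 c (w1 * c) := by
      rcases (not_lt.1 hcon).eq_or_lt with h' | h'
      · rwa [← h']
      · simpa using (hup _ (sub_pos.2 h') h)
    have := hsmul (inv_pos.2 hc) key
    refine (bin w1 hw le_rfl).1 ?_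
    convert this using 1 <;> field_simp <;> simp
  have B0' : ∀ c x : ℝ, c < 0 → U 0 c x → w0 * c < x := by
    intro c x hc h
    by_contra hcon
    have key : U 0 c (w0 * c) := by
      rcases (not_lt.1 hcon).eq_or_lt with h' | h'
      · rwa [← h']
      · simpa using (hup _ (sub_pos.2 h') h)
    have := hsmul (inv_pos.2 (neg_pos.2 hc)) key
    have hc' := hc.ne
    refine (bin w0 le_rfl hw).2 ?_
    convert this using 1 <;> field_simp <;> simp
  -- a point of `U` with coordinates of opposite sign
  have P : ∀ s s' r : ℝ, s * s' < 0 → U s s' r →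
      t0 * s + w0 * s' < r ∧ t1 * s + w1 * s' < r := by
    intro s s' r hs h
    obtain ⟨δ, hδ, h⟩ := hop h
    rcases mul_neg_iff.1 hs with ⟨h1, h2⟩ | ⟨h1, h2⟩
    · have e1 := hadd h (B1 (-s') (w1 * (-s') + δ / 2) (by linarith) (by linarith))
      have e0 := hadd h (A0 (-s) (t0 * (-s) + δ / 2) (by linarith) (by linarith))
      rw [add_neg_cancel, add_zero] at e1
      rw [add_neg_cancel, add_zero] at e0
      have e1 := A1' _ _ h1 e1
      have e0 := B0' _ _ h2 e0
      constructor <;> linarith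
    · have e1 := hadd h (A1 (-s) (t1 * (-s) + δ / 2) (by linarith) (by linarith))
      have e0 := hadd h (B0 (-s') (w0 * (-s') + δ / 2) (by linarith) (by linarith))
      rw [add_neg_cancel, add_zero] at e1
      rw [add_neg_cancel, add_zero] at e0
      have e1 := B1' _ _ h2 e1
      have e0 := A0' _ _ h1 e0
      constructor <;> linarith
  -- points above the hull
  have Q1 : ∀ s s' r : ℝ, 0 ≤ s → 0 ≤ s' → t1 * s + w1 * s' < r → U s s' r := by
    intro s s' r hs hs' h
    rcases hs.eq_or_lt with rfl | hs <;> rcases hs'.eq_or_lt with rfl | hs'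
    · simpa using hsmul (show 0 < r by linarith) he
    · exact B1 _ _ hs' (by linarith)
    · exact A1 _ _ hs (by linarith)
    · have := hadd (A1 s (t1 * s + (r - (t1 * s + w1 * s')) / 2) hs (by linarith))
        (B1 s' (w1 * s' + (r - (t1 * s + w1 * s')) / 2) hs' (by linarith))
      rw [add_zero, zero_add] at this
      convert this using 1; ring
  have Q0 : ∀ s s' r : ℝ, s ≤ 0 → s' ≤ 0 → t0 * s + w0 * s' < r → U s s' r := by
    intro s s' r hs hs' h
    rcases hs.eq_or_lt with rfl | hs <;> rcases hs'.eq_or_lt with rfl | hs'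
    · simpa using hsmul (show 0 < r by linarith) he
    · exact B0 _ _ hs' (by linarith)
    · exact A0 _ _ hs (by linarith)
    · have := hadd (A0 s (t0 * s + (r - (t0 * s + w0 * s')) / 2) hs (by linarith))
        (B0 s' (w0 * s' + (r - (t0 * s + w0 * s')) / 2) hs' (by linarith))
      rw [add_zero, zero_add] at this
      convert this using 1; ring
  constructor
  · intro H
    push Not at H
    obtain ⟨H1, H2, H3⟩ := H
    rcases lt_or_ge (s * s') 0 with hs | hs
    · by_cases hu : U s s' r
      · exact Or.inl ⟨hu, P _ _ _ hs hu⟩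
      · have := H1 hs hu
        exact Or.inr ⟨this, P _ _ _ (by nlinarith) this⟩
    · rcases mul_nonneg_iff.1 hs with ⟨h1, h2⟩ | ⟨h1, h2⟩
      · have m1 : t0 * s ≤ t1 * s := by gcongr
        have m2 : w0 * s' ≤ w1 * s' := by gcongr
        by_cases hl : t0 * s + w0 * s' ≤ r
        · have := H2 h1 h2 hl
          exact Or.inl ⟨Q1 _ _ _ h1 h2 this, by linarith, this⟩
        · push Not at hl
          exact Or.inr ⟨Q0 _ _ _ (by linarith) (by linarith) (by linarith), by linarith,
            by linarith⟩
      · have m1 : t1 * s ≤ t0 * s := mul_le_mul_of_nonpos_right h01 h1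
        have m2 : w1 * s' ≤ w0 * s' := mul_le_mul_of_nonpos_right hw h2
        by_cases hl : t1 * s + w1 * s' ≤ r
        · have := H3 h1 h2 hl
          exact Or.inl ⟨Q0 _ _ _ h1 h2 this, by linarith, by linarith⟩
        · push Not at hl
          exact Or.inr ⟨Q1 _ _ _ (by linarith) (by linarith) (by linarith), by linarith,
            by linarith⟩
  · rintro (⟨h1, h2, h3⟩ | ⟨h1, h2, h3⟩) (⟨g1, g2, g3⟩ | ⟨g1, g2, g3, g4⟩ | ⟨g1, g2, g3, g4⟩)
    · exact g2 h1
    · linarith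
    · linarith
    · exact g3 h1
    · linarith
    · linarith

section Cones

variable {E : Type*} [AddCommGroup E] [Module ℝ E]

/-- The cone (without the origin) over a subset of a projective space. -/
def cn (X : Set (Projectivization ℝ E)) : Set E :=
  {v | ∃ h : v ≠ 0, Projectivization.mk ℝ v h ∈ X}

theorem cn_ne_zero {X : Set (Projectivization ℝ E)} {v : E} (h : v ∈ cn X) : v ≠ 0 := h.1

theorem mem_iff_rep_cn {X : Set (Projectivization ℝ E)} {x : Projectivization ℝ E} :
    x ∈ X ↔ x.rep ∈ cn X := by
  simp [cn, x.rep_nonzero]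

theorem cn_smul {X : Set (Projectivization ℝ E)} {v : E} {c : ℝ} (hc : c ≠ 0) :
    c • v ∈ cn X ↔ v ∈ cn X := by
  have : ∀ (v : E) (c : ℝ), c ≠ 0 → v ∈ cn X → c • v ∈ cn X := by
    rintro v c hc ⟨h, hv⟩
    refine ⟨smul_ne_zero hc h, ?_⟩
    rwa [(Projectivization.mk_eq_mk_iff' ℝ _ _ (smul_ne_zero hc h) h).2 ⟨c, rfl⟩]
  refine ⟨fun h => ?_, this v c hc⟩
  simpa [smul_smul, inv_mul_cancel₀ hc] using this _ _ (inv_ne_zero hc) h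

theorem cn_neg {X : Set (Projectivization ℝ E)} {v : E} : -v ∈ cn X ↔ v ∈ cn X := by
  rw [← neg_one_smul ℝ, cn_smul (by norm_num)]

/-- The cone over a set described by a scale-invariant condition on representatives. -/
theorem mem_cn_of {X : Set (Projectivization ℝ E)} {P : E → Prop}
    (hP : ∀ (v : E) (c : ℝ), c ≠ 0 → P v → P (c • v)) (hX : ∀ x, x ∈ X ↔ P x.rep) {v : E} :
    v ∈ cn X ↔ v ≠ 0 ∧ P v := by
  have : ∀ h : v ≠ 0, (Projectivization.mk ℝ v h ∈ X ↔ P v) := by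
    intro h
    rw [hX]
    obtain ⟨a, ha⟩ := Projectivization.exists_smul_eq_mk_rep ℝ v h
    rw [← ha]
    refine ⟨fun h' => ?_, hP v a a.ne_zero⟩
    have := hP _ (a : ℝ)⁻¹ (inv_ne_zero a.ne_zero) h'
    rwa [Units.smul_def, smul_smul, inv_mul_cancel₀ a.ne_zero, one_smul] at this
  constructor
  · rintro ⟨h, h'⟩
    exact ⟨h, (this h).1 h'⟩
  · rintro ⟨h, h'⟩
    exact ⟨h, (this h).2 h'⟩

theorem set_ext_cn {X Y : Set (Projectivization ℝ E)} (h : ∀ v, v ∈ cn X ↔ v ∈ cn Y) :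
    X = Y := by
  ext x
  rw [mem_iff_rep_cn, mem_iff_rep_cn (X := Y), h]

theorem cn_compl {X : Set (Projectivization ℝ E)} {v : E} :
    v ∈ cn Xᶜ ↔ v ≠ 0 ∧ v ∉ cn X := by
  constructor
  · rintro ⟨h, h'⟩
    exact ⟨h, fun ⟨_, h''⟩ => h' h''⟩
  · rintro ⟨h, h'⟩
    exact ⟨h, fun h'' => h' ⟨h, h''⟩⟩

theorem cn_inter_projSet {X : Set (Projectivization ℝ E)} {N : Submodule ℝ E} {v : E} :
    v ∈ cn (X ∩ projSet N) ↔ v ∈ cn X ∧ v ∈ N := by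
  rw [mem_cn_of (P := fun v => v ∈ cn X ∧ v ∈ N)]
  · exact ⟨fun h => h.2, fun h => ⟨h.1.1, h⟩⟩
  · rintro v c hc ⟨h1, h2⟩
    exact ⟨(cn_smul hc).2 h1, N.smul_mem _ h2⟩
  · intro x
    rw [← mem_iff_rep_cn]
    rfl

theorem mem_submodule_iff {y : Projectivization ℝ E} {v : E} (hv : v ≠ 0) :
    v ∈ y.submodule ↔ Projectivization.mk ℝ v hv = y := by
  induction y with
  | h w hw =>
    rw [Projectivization.submodule_mk, Submodule.mem_span_singleton,
      Projectivization.mk_eq_mk_iff']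

theorem chart_image {X : Set (Projectivization ℝ E)} {φ : Module.Dual ℝ E}
    (h : ∀ x ∈ X, φ x.rep ≠ 0) : projChart φ '' X = {v | φ v = 1 ∧ v ∈ cn X} := by
  ext v
  constructor
  · rintro ⟨x, hx, rfl⟩
    refine ⟨by simp [projChart, h x hx], ?_⟩
    exact (cn_smul (inv_ne_zero (h x hx))).2 (mem_iff_rep_cn.1 hx)
  · rintro ⟨h1, h2, h3⟩
    refine ⟨_, h3, ?_⟩
    obtain ⟨a, ha⟩ := Projectivization.exists_smul_eq_mk_rep ℝ v h2
    rw [projChart, ← ha, Units.smul_def]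
    simp [h1, smul_smul]

theorem isProjConvex_iff {X : Set (Projectivization ℝ E)} :
    IsProjConvex X ↔ ∃ φ : Module.Dual ℝ E, φ ≠ 0 ∧ (∀ v ∈ cn X, φ v ≠ 0) ∧
      ∀ u ∈ cn X, ∀ v ∈ cn X, 0 < φ u → 0 < φ v → u + v ∈ cn X := by
  unfold IsProjConvex
  refine exists_congr fun φ => and_congr_right fun _ => ?_
  have e1 : (∀ x ∈ X, φ x.rep ≠ 0) ↔ ∀ v ∈ cn X, φ v ≠ 0 := by
    constructor
    · rintro h v ⟨h1, h2⟩
      have := h _ h2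
      obtain ⟨a, ha⟩ := Projectivization.exists_smul_eq_mk_rep ℝ v h1
      rw [← ha, Units.smul_def, map_smul] at this
      exact right_ne_zero_of_mul this
    · exact fun h x hx => h _ (mem_iff_rep_cn.1 hx)
  rw [← e1]
  refine and_congr_right fun h => ?_
  rw [chart_image h]
  constructor
  · intro hc u hu v hv hu' hv'
    have hu1 : (φ u)⁻¹ • u ∈ {v | φ v = 1 ∧ v ∈ cn X} :=
      ⟨by simp [hu'.ne'], (cn_smul (inv_ne_zero hu'.ne')).2 hu⟩
    have hv1 : (φ v)⁻¹ • v ∈ {v | φ v = 1 ∧ v ∈ cn X} :=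
      ⟨by simp [hv'.ne'], (cn_smul (inv_ne_zero hv'.ne')).2 hv⟩
    have hs : 0 < φ u + φ v := by linarith
    have := (hc hu1 hv1 (a := φ u / (φ u + φ v)) (b := φ v / (φ u + φ v)) (by positivity)
      (by positivity) (by field_simp)).2
    rw [← cn_smul (c := φ u + φ v) hs.ne'] at this
    convert this using 1
    rw [smul_add, smul_smul, smul_smul, smul_smul, smul_smul]
    congr 1
    · rw [show (φ u + φ v) * (φ u / (φ u + φ v)) * (φ u)⁻¹ = 1 by field_simp, one_smul]
    · rw [show (φ u + φ v) * (φ v / (φ u + φ v)) * (φ v)⁻¹ = 1 by field_simp, one_smul]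
  · rintro H u ⟨hu1, hu⟩ v ⟨hv1, hv⟩ s t hs ht hst
    refine ⟨by simp [hu1, hv1, hst], ?_⟩
    rcases hs.eq_or_lt with rfl | hs
    · rw [zero_add] at hst; simpa [hst] using hv
    rcases ht.eq_or_lt with rfl | ht
    · rw [add_zero] at hst; simpa [hst] using hu
    exact H _ ((cn_smul hs.ne').2 hu) _ ((cn_smul ht.ne').2 hv) (by simp [hu1, hs])
      (by simp [hv1, ht])

theorem isOpen_of_cn [TopologicalSpace E] {X : Set (Projectivization ℝ E)}
    (h : IsOpen (cn X)) : IsOpen X := by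
  refine isOpen_coinduced.2 ?_
  convert h.preimage (continuous_subtype_val (p := fun v : E => v ≠ 0)) using 1
  ext v
  exact ⟨fun h => ⟨v.2, h⟩, fun h => h.2⟩

theorem isOpen_cn [TopologicalSpace E] [T1Space E] {X : Set (Projectivization ℝ E)}
    (h : IsOpen X) : IsOpen (cn X) := by
  have h2 := isOpen_coinduced.1 h
  have h3 : IsOpen {v : E | v ≠ 0} := isOpen_ne
  convert h3.isOpenMap_subtype_val _ h2 using 1
  ext v
  constructor
  · rintro ⟨h, h'⟩
    exact ⟨⟨v, h⟩, h', rfl⟩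
  · rintro ⟨⟨w, h⟩, h', rfl⟩
    exact ⟨h, h'⟩

theorem cn_projImage {T : Submodule ℝ E} {A : Set (Projectivization ℝ E)} {z : E ⧸ T} :
    z ∈ cn (projImage T A) ↔ z ≠ 0 ∧ ∃ v ∈ cn A, T.mkQ v = z := by
  constructor
  · rintro ⟨hz, x, hx, hxT, hxz⟩
    refine ⟨hz, ?_⟩
    have h0 : T.mkQ x.rep ≠ 0 := by simpa using hxT
    rw [mem_submodule_iff h0, Projectivization.mk_eq_mk_iff'] at hxz
    obtain ⟨c, hc⟩ := hxz
    have hc0 : c ≠ 0 := by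
      rintro rfl
      rw [zero_smul] at hc
      exact h0 hc.symm
    refine ⟨c⁻¹ • x.rep, (cn_smul (inv_ne_zero hc0)).2 (mem_iff_rep_cn.1 hx), ?_⟩
    rw [map_smul, ← hc, smul_smul, inv_mul_cancel₀ hc0, one_smul]
  · rintro ⟨hz, v, ⟨hv, hvA⟩, rfl⟩
    refine ⟨hz, _, hvA, ?_, ?_⟩
    · obtain ⟨a, ha⟩ := Projectivization.exists_smul_eq_mk_rep ℝ v hv
      rw [← ha, Units.smul_def, T.smul_mem_iff a.ne_zero]
      simpa using hz
    · obtain ⟨a, ha⟩ := Projectivization.exists_smul_eq_mk_rep ℝ v hv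
      rw [← ha, Units.smul_def, map_smul, Projectivization.submodule_mk]
      exact Submodule.smul_mem _ _ (Submodule.mem_span_singleton_self _)

end Cones

section ArcSection

variable {Q : Type*} [AddCommGroup Q] [Module ℝ Q] [TopologicalSpace Q]
  [IsTopologicalAddGroup Q] [ContinuousSMul ℝ Q] [T2Space Q] [FiniteDimensional ℝ Q]

/-- The open set of points of the projective space where a certain quadratic inequality holds. -/
theorem quad_open (β φ : Module.Dual ℝ Q) (u k : ℝ) :
    ∃ O : Set (Projectivization ℝ Q), IsOpen O ∧
      ∀ z, z ∈ cn O ↔ z ≠ 0 ∧ k * (β z * φ z) < k * (u * φ z ^ 2) := by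
  let O : Set (Projectivization ℝ Q) :=
    {x | k * (β x.rep * φ x.rep) < k * (u * φ x.rep ^ 2)}
  have hO : ∀ z, z ∈ cn O ↔ z ≠ 0 ∧ k * (β z * φ z) < k * (u * φ z ^ 2) := by
    intro z
    refine mem_cn_of (P := fun z => k * (β z * φ z) < k * (u * φ z ^ 2)) ?_ (fun x => Iff.rfl)
    intro v c hc h
    have : 0 < c ^ 2 := by positivity
    simp only [map_smul, smul_eq_mul]
    nlinarith
  refine ⟨O, isOpen_of_cn ?_, hO⟩
  have hβ := β.continuous_of_finiteDimensional
  have hφ := φ.continuous_of_finiteDimensional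
  have : cn O = {z | z ≠ 0} ∩ {z | k * (β z * φ z) < k * (u * φ z ^ 2)} := by
    ext z; exact hO z
  rw [this]
  exact isOpen_ne.inter (isOpen_lt (by fun_prop) (by fun_prop))

theorem arc_desc (α β : Module.Dual ℝ Q) (v1 v2 : Q) (h11 : α v1 = 1) (h12 : β v1 = 0)
    (h21 : α v2 = 0) (h22 : β v2 = 1) (hsp : ∀ z, z = α z • v1 + β z • v2)
    (Arc : Set (Projectivization ℝ Q)) (hconn : IsConnected Arc)
    (a b : Projectivization ℝ Q) (ha : v1 ∈ cn {a}) (hb : v2 ∈ cn {b})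
    (haA : a ∈ Arc) (hbA : b ∈ Arc) (hfr : frontier Arc = {a, b})
    (hc : ∀ z, α z + β z = 0 → z ∉ cn Arc) (z : Q) :
    z ∈ cn Arc ↔ z ≠ 0 ∧ 0 ≤ α z * β z := by
  set φ : Module.Dual ℝ Q := α + β with hφ
  have hφz : ∀ z, φ z = α z + β z := fun z => rfl
  let γ : ℝ → Q := fun t => (1 - t) • v1 + t • v2
  have hαγ : ∀ t, α (γ t) = 1 - t := by intro t; simp [γ, h11, h21]
  have hβγ : ∀ t, β (γ t) = t := by intro t; simp [γ, h12, h22]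
  have hφγ : ∀ t, φ (γ t) = 1 := by intro t; rw [hφz, hαγ, hβγ]; ring
  have hγ0 : ∀ t, γ t ≠ 0 := by
    intro t h
    have := hφγ t
    rw [h, map_zero] at this
    exact zero_ne_one this
  have hzγ : ∀ z, φ z ≠ 0 → z = φ z • γ (β z / φ z) := by
    intro z hz
    conv_lhs => rw [hsp z]
    simp only [γ, smul_add, smul_smul]
    rw [mul_div_cancel₀ _ hz, mul_sub, mul_div_cancel₀ _ hz, hφz]
    congr 2; ring
  have hcnγ : ∀ z, z ∈ cn Arc ↔ φ z ≠ 0 ∧ γ (β z / φ z) ∈ cn Arc := by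
    intro z
    constructor
    · intro h
      have h' : φ z ≠ 0 := fun h' => hc z h' h
      refine ⟨h', ?_⟩
      rw [hzγ z h', cn_smul h'] at h
      exact h
    · rintro ⟨h', h⟩
      rwa [hzγ z h', cn_smul h']
  have hbtw : ∀ t1 u t2 : ℝ, γ t1 ∈ cn Arc → γ t2 ∈ cn Arc → t1 < u → u < t2 →
      γ u ∈ cn Arc := by
    intro t1 u t2 h1 h2 h1u hu2
    by_contra hu
    obtain ⟨O1, hO1, hO1'⟩ := quad_open β φ u 1
    obtain ⟨O2, hO2, hO2'⟩ := quad_open β φ u (-1)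
    have key := hconn.isPreconnected O1 O2 hO1 hO2 ?_ ⟨_, h1.2, ?_⟩ ⟨_, h2.2, ?_⟩
    · obtain ⟨x, -, hx1, hx2⟩ := key
      rw [mem_iff_rep_cn, hO1'] at hx1
      rw [mem_iff_rep_cn, hO2'] at hx2
      linarith [hx1.2, hx2.2]
    · intro x hx
      rw [mem_iff_rep_cn] at hx
      obtain ⟨hx1, hx2⟩ := (hcnγ _).1 hx
      have hne : β x.rep / φ x.rep ≠ u := by
        intro h
        rw [h] at hx2
        exact hu hx2
      have hne' : β x.rep * φ x.rep ≠ u * φ x.rep ^ 2 := by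
        intro h
        apply hne
        field_simp
        apply mul_right_cancel₀ hx1
        rw [h]; ring
      rcases lt_or_gt_of_ne hne' with h | h
      · left
        rw [mem_iff_rep_cn, hO1']
        exact ⟨x.rep_nonzero, by linarith⟩
      · right
        rw [mem_iff_rep_cn, hO2']
        exact ⟨x.rep_nonzero, by linarith⟩
    · exact ((hO1' _).2 ⟨hγ0 t1, by rw [hβγ, hφγ]; linarith⟩).2
    · exact ((hO2' _).2 ⟨hγ0 t2, by rw [hβγ, hφγ]; linarith⟩).2
  have hγ0' : γ 0 = v1 := by simp [γ]
  have hγ1' : γ 1 = v2 := by simp [γ]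
  have hA0 : γ 0 ∈ cn Arc := by
    rw [hγ0']
    obtain ⟨h, h'⟩ := ha
    exact ⟨h, by rw [h']; exact haA⟩
  have hA1 : γ 1 ∈ cn Arc := by
    rw [hγ1']
    obtain ⟨h, h'⟩ := hb
    exact ⟨h, by rw [h']; exact hbA⟩
  have hbetween : ∀ (t1 u t2 : ℝ), γ t1 ∈ cn Arc → γ t2 ∈ cn Arc → t1 < u → u < t2 →
      ∀ y, y ∈ frontier Arc → γ u ∉ cn {y} := by
    rintro t1 u t2 h1 h2 h1u hu2 y hy ⟨hu0, hyu⟩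
    obtain ⟨O1, hO1, hO1'⟩ := quad_open β φ t2 1
    obtain ⟨O2, hO2, hO2'⟩ := quad_open β φ t1 (-1)
    have hsub : O1 ∩ O2 ⊆ Arc := by
      rintro x ⟨hx1, hx2⟩
      rw [mem_iff_rep_cn, hO1'] at hx1
      rw [mem_iff_rep_cn, hO2'] at hx2
      have hx1 := hx1.2
      have hx2 := hx2.2
      have hn : φ x.rep ≠ 0 := by
        intro h
        rw [h] at hx1
        simp at hx1
      have hp : 0 < φ x.rep ^ 2 := by positivity
      have e : β x.rep / φ x.rep * φ x.rep ^ 2 = β x.rep * φ x.rep := by field_simp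
      rw [mem_iff_rep_cn, hcnγ]
      refine ⟨hn, hbtw t1 _ t2 h1 h2 ?_ ?_⟩
      · by_contra hcon
        push Not at hcon
        nlinarith
      · by_contra hcon
        push Not at hcon
        nlinarith
    have hyi : y ∈ interior Arc := by
      refine mem_interior.2 ⟨_, hsub, hO1.inter hO2, ?_⟩
      rw [← show _ = y from hyu]
      exact ⟨((hO1' _).2 ⟨hu0, by rw [hβγ, hφγ]; linarith⟩).2,
        ((hO2' _).2 ⟨hu0, by rw [hβγ, hφγ]; linarith⟩).2⟩
    exact hy.2 hyi
  have hI : ∀ t, γ t ∈ cn Arc ↔ 0 ≤ t ∧ t ≤ 1 := by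
    intro t
    constructor
    · intro h
      constructor
      · by_contra hcon
        push Not at hcon
        exact hbetween t 0 1 h hA1 hcon one_pos a (by rw [hfr]; simp) (by rwa [hγ0'])
      · by_contra hcon
        push Not at hcon
        exact hbetween 0 1 t hA0 h one_pos hcon b (by rw [hfr]; simp) (by rwa [hγ1'])
    · rintro ⟨h1, h2⟩
      rcases h1.eq_or_lt with rfl | h1
      · exact hA0
      rcases h2.eq_or_lt with rfl | h2
      · exact hA1
      exact hbtw 0 t 1 hA0 hA1 h1 h2
  rw [hcnγ, hI]
  have hz0 : z ≠ 0 ↔ ¬(α z = 0 ∧ β z = 0) := by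
    rw [not_iff_not]
    constructor
    · rintro rfl; simp
    · rintro ⟨h1, h2⟩
      rw [hsp z, h1, h2]; simp
  rw [hz0, hφz]
  generalize α z = s
  generalize β z = t
  constructor
  · rintro ⟨h1, h2, h3⟩
    have e : t / (s + t) * (s + t) = t := by field_simp
    have hp : 0 < (s + t) ^ 2 := by positivity
    refine ⟨fun h => h1 (by rw [h.1, h.2, add_zero]), ?_⟩
    set q := t / (s + t)
    have : s * t = (1 - q) * q * (s + t) ^ 2 := by
      have e2 : (1 - q) * q * (s + t) ^ 2 = ((s + t) - q * (s + t)) * (q * (s + t)) := by ring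
      rw [e2, e]; ring
    rw [this]
    have := sub_nonneg.2 h3
    positivity
  · rintro ⟨h1, h2⟩
    have h : s + t ≠ 0 := by
      intro h
      apply h1
      have : s = -t := by linarith
      subst this
      have : t * t = 0 := by nlinarith
      have : t = 0 := by simpa using this
      simp [this]
    refine ⟨h, ?_⟩
    have hp : 0 < (s + t) ^ 2 := by positivity
    have e : t / (s + t) * (s + t) ^ 2 = t * (s + t) := by field_simp
    constructor
    · by_contra hcon
      push Not at hcon
      nlinarith [sq_nonneg t]
    · by_contra hcon
      push Not at hcon
      nlinarith [sq_nonneg s]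

end ArcSection

section Surgery

variable {V : Type*} [AddCommGroup V] [Module ℝ V]

/-- The normalized section of the cone over `A`. -/
def KK (α β : Module.Dual ℝ V) (A : Set (Projectivization ℝ V)) : Set V :=
  {v | α v = 1 ∧ β v = 0 ∧ v ∈ cn A}

/-- The cone over the surgery, described by the coordinates `α, β`. -/
def SC (α β : Module.Dual ℝ V) (A : Set (Projectivization ℝ V)) : Set V :=
  {v | v ≠ 0 ∧ ((α v * β v < 0 ∧ v ∈ cn A) ∨
    (0 ≤ α v * β v ∧ ∃ p ∈ KK α β A, ∃ q ∈ KK β α A, v = α v • p + β v • q))}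

theorem comb_mem {K : Set V} (hK : Convex ℝ K) {p p' : V} (hp : p ∈ K) (hp' : p' ∈ K)
    {κ s t : ℝ} (hκ : κ ≠ 0) (hs : 0 ≤ κ * s) (ht : 0 ≤ κ * t) :
    ∃ r ∈ K, s • p + t • p' = (s + t) • r := by
  have key : ∀ s t : ℝ, 0 ≤ s → 0 ≤ t → ∃ r ∈ K, s • p + t • p' = (s + t) • r := by
    intro s t hs ht
    rcases (add_nonneg hs ht).eq_or_lt with h | h
    · have h1 : s = 0 := by linarith
      have h2 : t = 0 := by linarith
      exact ⟨p, hp, by simp [h1, h2]⟩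
    · refine ⟨(s / (s + t)) • p + (t / (s + t)) • p', hK hp hp' (by positivity) (by positivity)
        (by field_simp), ?_⟩
      rw [smul_add, smul_smul, smul_smul, mul_div_cancel₀ _ h.ne', mul_div_cancel₀ _ h.ne']
  rcases lt_or_gt_of_ne hκ with h | h
  · obtain ⟨r, hr, e⟩ := key (-s) (-t) (by nlinarith) (by nlinarith)
    refine ⟨r, hr, ?_⟩
    rw [← neg_inj]
    calc _ = -s • p + -t • p' := by simp only [neg_smul]; abel
      _ = _ := by rw [e, ← neg_smul]; congr 1; ring
  · exact key s t (nonneg_of_mul_nonneg_right hs h) (nonneg_of_mul_nonneg_right ht h)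

variable {W : Submodule ℝ V} {A : Set (Projectivization ℝ V)} {α β : Module.Dual ℝ V}

theorem hull_iff (hKa : Convex ℝ (KK α β A)) (hKb : Convex ℝ (KK β α A))
    (hna : (KK α β A).Nonempty) (hnb : (KK β α A).Nonempty)
    {φ : Module.Dual ℝ V} {κ κ' : ℝ} (hφ : ∀ v, φ v = κ * α v + κ' * β v) (hκ : 0 < κ * κ')
    (v : V) (hv : ¬(α v = 0 ∧ β v = 0)) (hv' : 0 ≤ α v * β v) :
    (φ v ≠ 0 ∧ (φ v)⁻¹ • v ∈
        convexHull ℝ {v | φ v = 1 ∧ v ∈ cn A ∧ (β v = 0 ∨ α v = 0)}) ↔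
      ∃ p ∈ KK α β A, ∃ q ∈ KK β α A, v = α v • p + β v • q := by
  have k1 : κ ≠ 0 := left_ne_zero_of_mul hκ.ne'
  have k2 : κ' ≠ 0 := right_ne_zero_of_mul hκ.ne'
  constructor
  · rintro ⟨h0, h1⟩
    let C : Set V := {u | 0 ≤ κ * α u ∧ 0 ≤ κ' * β u ∧
      ∃ p ∈ KK α β A, ∃ q ∈ KK β α A, u = α u • p + β u • q}
    have hC : Convex ℝ C := by
      rintro u ⟨u1, u2, p, hp, q, hq, hu⟩ w ⟨w1, w2, p', hp', q', hq', hw⟩ s t hs ht -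
      obtain ⟨p2, hp2, e1⟩ := comb_mem hKa hp hp' (s := s * α u) (t := t * α w) k1
        (by rw [mul_left_comm]; positivity) (by rw [mul_left_comm]; positivity)
      obtain ⟨q2, hq2, e2⟩ := comb_mem hKb hq hq' (s := s * β u) (t := t * β w) k2
        (by rw [mul_left_comm]; positivity) (by rw [mul_left_comm]; positivity)
      refine ⟨?_, ?_, p2, hp2, q2, hq2, ?_⟩
      · simp only [map_add, map_smul, smul_eq_mul]
        have a1 := mul_nonneg hs u1
        have a2 := mul_nonneg ht w1
        linarith
      · simp only [map_add, map_smul, smul_eq_mul]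
        have a1 := mul_nonneg hs u2
        have a2 := mul_nonneg ht w2
        linarith
      · simp only [map_add, map_smul, smul_eq_mul]
        rw [← e1, ← e2]
        conv_lhs => rw [hu, hw]
        module
    have hsub : {v | φ v = 1 ∧ v ∈ cn A ∧ (β v = 0 ∨ α v = 0)} ⊆ C := by
      obtain ⟨p0, hp0⟩ := hna
      obtain ⟨q0, hq0⟩ := hnb
      rintro u ⟨u1, u2, u3⟩
      rw [hφ] at u1
      rcases u3 with u3 | u3
      · rw [u3, mul_zero, add_zero] at u1
        have h : α u ≠ 0 := right_ne_zero_of_mul (u1 ▸ one_ne_zero)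
        refine ⟨by rw [u1]; exact zero_le_one, by simp [u3], (α u)⁻¹ • u,
          ⟨by simp [h], by simp [u3], (cn_smul (inv_ne_zero h)).2 u2⟩, q0, hq0, ?_⟩
        simp [u3, smul_smul, h]
      · rw [u3, mul_zero, zero_add] at u1
        have h : β u ≠ 0 := right_ne_zero_of_mul (u1 ▸ one_ne_zero)
        refine ⟨by simp [u3], by rw [u1]; exact zero_le_one, p0, hp0, (β u)⁻¹ • u,
          ⟨by simp [h], by simp [u3], (cn_smul (inv_ne_zero h)).2 u2⟩, ?_⟩
        simp [u3, smul_smul, h]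
    obtain ⟨-, -, p, hp, q, hq, e⟩ := convexHull_min hsub hC h1
    refine ⟨p, hp, q, hq, ?_⟩
    have e' := congrArg (fun u => φ v • u) e
    simpa [smul_smul, h0, ← mul_assoc] using e'
  · rintro ⟨p, hp, q, hq, e⟩
    have h0 : φ v ≠ 0 := by
      intro h
      rw [hφ] at h
      have e1 : κ * α v = -(κ' * β v) := by linarith
      have e2 : (κ * κ') * (α v * β v) = -(κ' * β v) ^ 2 := by
        linear_combination (κ' * β v) * e1
      have e3 : (κ' * β v) ^ 2 = 0 := by nlinarith [mul_nonneg hκ.le hv', sq_nonneg (κ' * β v)]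
      have e4 : β v = 0 := by simpa [k2] using e3
      rw [e4, mul_zero, neg_zero] at e1
      exact hv ⟨by simpa [k1] using e1, e4⟩
    refine ⟨h0, ?_⟩
    have hs : 0 < φ v ^ 2 := by positivity
    have hab := mul_nonneg hκ.le hv'
    have m1 : κ⁻¹ • p ∈ {v | φ v = 1 ∧ v ∈ cn A ∧ (β v = 0 ∨ α v = 0)} :=
      ⟨by rw [hφ]; simp [hp.1, hp.2.1, k1], (cn_smul (inv_ne_zero k1)).2 hp.2.2,
        Or.inl (by simp [hp.2.1])⟩
    have m2 : κ'⁻¹ • q ∈ {v | φ v = 1 ∧ v ∈ cn A ∧ (β v = 0 ∨ α v = 0)} :=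
      ⟨by rw [hφ]; simp [hq.1, hq.2.1, k2], (cn_smul (inv_ne_zero k2)).2 hq.2.2,
        Or.inr (by simp [hq.2.1])⟩
    have := convex_convexHull ℝ _ (subset_convexHull ℝ _ m1) (subset_convexHull ℝ _ m2)
      (a := κ * α v / φ v) (b := κ' * β v / φ v) ?_ ?_ ?_
    · convert this using 1
      have e5 : (φ v)⁻¹ • v = (φ v)⁻¹ • (α v • p + β v • q) := congrArg _ e
      rw [e5]
      simp only [smul_add, smul_smul]
      congr 2 <;> field_simp
    · rw [show κ * α v / φ v = (κ * α v * φ v) / φ v ^ 2 by field_simp]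
      apply div_nonneg _ hs.le
      rw [hφ]
      nlinarith [sq_nonneg (κ * α v)]
    · rw [show κ' * β v / φ v = (κ' * β v * φ v) / φ v ^ 2 by field_simp]
      apply div_nonneg _ hs.le
      rw [hφ]
      nlinarith [sq_nonneg (κ' * β v)]
    · rw [← add_div, ← hφ, div_self h0]

theorem surgery_cn (hKa : Convex ℝ (KK α β A)) (hKb : Convex ℝ (KK β α A))
    (hna : (KK α β A).Nonempty) (hnb : (KK β α A).Nonempty)
    (hW : ∀ v, v ∈ W ↔ α v = 0 ∧ β v = 0) (hAW : ∀ v ∈ cn A, v ∉ W)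
    {a b : Projectivization ℝ (V ⧸ W)} {Arc : Set (Projectivization ℝ (V ⧸ W))}
    (ha : ∀ v, W.mkQ v ∈ a.submodule ↔ β v = 0)
    (hb : ∀ v, W.mkQ v ∈ b.submodule ↔ α v = 0)
    (hArc : ∀ v, v ∉ W → ((∃ y ∈ Arc, W.mkQ v ∈ y.submodule) ↔ 0 ≤ α v * β v))
    {φ : Module.Dual ℝ V} {κ κ' : ℝ} (hφ : ∀ v, φ v = κ * α v + κ' * β v) (hκ : 0 < κ * κ')
    (v : V) : v ∈ cn (surgery W a b Arc φ A) ↔ v ∈ SC α β A := by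
  have k1 : κ ≠ 0 := left_ne_zero_of_mul hκ.ne'
  have k2 : κ' ≠ 0 := right_ne_zero_of_mul hκ.ne'
  have him : projChart φ '' (A ∩ (gammaSet W a ∪ gammaSet W b)) =
      {v | φ v = 1 ∧ v ∈ cn A ∧ (β v = 0 ∨ α v = 0)} := by
    have hx : ∀ x, x ∈ A ∩ (gammaSet W a ∪ gammaSet W b) ↔
        x.rep ∈ cn A ∧ (β x.rep = 0 ∨ α x.rep = 0) := by
      intro x
      rw [← mem_iff_rep_cn, ← ha, ← hb]
      rfl
    rw [chart_image]
    · ext v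
      refine and_congr_right fun h1 => ?_
      rw [mem_cn_of (P := fun v => v ∈ cn A ∧ (β v = 0 ∨ α v = 0)) _ hx]
      · exact ⟨fun h => h.2, fun h => ⟨h.1.1, h⟩⟩
      · rintro v c hc ⟨h1, h2⟩
        refine ⟨(cn_smul hc).2 h1, ?_⟩
        simpa [hc] using h2
    · intro x hxm
      obtain ⟨h1, h2⟩ := (hx x).1 hxm
      have h3 := hAW _ h1
      rw [hW] at h3
      rw [hφ]
      rcases h2 with h2 | h2
      · have : α x.rep ≠ 0 := fun h => h3 ⟨h, h2⟩
        simp [h2, k1, this]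
      · have : β x.rep ≠ 0 := fun h => h3 ⟨h2, h⟩
        simp [h2, k2, this]
  rw [mem_cn_of (P := fun v => v ∉ W ∧ (0 ≤ α v * β v → φ v ≠ 0 ∧ (φ v)⁻¹ • v ∈
        convexHull ℝ {v | φ v = 1 ∧ v ∈ cn A ∧ (β v = 0 ∨ α v = 0)}) ∧
      (¬0 ≤ α v * β v → v ∈ cn A))]
  · refine and_congr_right fun hv0 => ?_
    constructor
    · rintro ⟨h1, h2, h3⟩
      rcases lt_or_ge (α v * β v) 0 with h | h
      · exact Or.inl ⟨h, h3 (not_le.2 h)⟩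
      · exact Or.inr ⟨h, (hull_iff hKa hKb hna hnb hφ hκ v (by rwa [← hW]) h).1 (h2 h)⟩
    · rintro (⟨h1, h2⟩ | ⟨h1, h2⟩)
      · exact ⟨hAW _ h2, fun h => absurd h (not_le.2 h1), fun _ => h2⟩
      · have hvW : v ∉ W := by
          rw [hW]
          rintro ⟨e1, e2⟩
          obtain ⟨p, -, q, -, e⟩ := h2
          rw [e1, e2] at e
          exact hv0 (by simpa using e)
        exact ⟨hvW, fun _ => (hull_iff hKa hKb hna hnb hφ hκ v (by rwa [← hW]) h1).2 h2,
          fun h => absurd h1 h⟩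
  · rintro v c hc ⟨h1, h2, h3⟩
    have hc2 : 0 < c ^ 2 := by positivity
    have e1 : (0 ≤ α (c • v) * β (c • v)) ↔ 0 ≤ α v * β v := by
      simp only [map_smul, smul_eq_mul]
      rw [show c * α v * (c * β v) = c ^ 2 * (α v * β v) by ring]
      exact mul_nonneg_iff_of_pos_left hc2
    have e2 : (φ (c • v))⁻¹ • c • v = (φ v)⁻¹ • v := by
      rw [map_smul, smul_smul, smul_eq_mul]
      congr 1
      field_simp
    refine ⟨by rwa [W.smul_mem_iff hc], ?_, ?_⟩
    · rw [e1, e2]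
      intro h
      refine ⟨?_, (h2 h).2⟩
      simpa [hc] using (h2 h).1
    · rw [e1]
      exact fun h => (cn_smul hc).2 (h3 h)
  · intro x
    unfold surgery
    rw [mem_ofPred_eq]
    refine and_congr_right fun hx => ?_
    rw [hArc _ hx, him, ← mem_iff_rep_cn]
    rfl

/-- Convexity and non-emptiness of the normalized sections. -/
theorem KK_convex (hW : ∀ v, v ∈ W ↔ α v = 0 ∧ β v = 0) (hAW : ∀ v ∈ cn A, v ∉ W)
    (h : (A ∩ projSet (LinearMap.ker β)).Nonempty ∧
      IsProjConvex (A ∩ projSet (LinearMap.ker β))) :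
    Convex ℝ (KK α β A) ∧ (KK α β A).Nonempty := by
  obtain ⟨⟨x, hx⟩, h2⟩ := h
  constructor
  · obtain ⟨ψ, -, hψ, hadd⟩ := isProjConvex_iff.1 h2
    have hcn : ∀ v, v ∈ cn (A ∩ projSet (LinearMap.ker β)) ↔ v ∈ cn A ∧ β v = 0 := by
      intro v
      rw [cn_inter_projSet, LinearMap.mem_ker]
    rintro p ⟨p1, p2, p3⟩ q ⟨q1, q2, q3⟩ s t hs ht hst
    refine ⟨by simp [p1, q1, hst], by simp [p2, q2], ?_⟩
    rcases hs.eq_or_lt with rfl | hs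
    · rw [zero_add] at hst; simpa [hst] using q3
    rcases ht.eq_or_lt with rfl | ht
    · rw [add_zero] at hst; simpa [hst] using p3
    have hp := (hcn p).2 ⟨p3, p2⟩
    have hq := (hcn q).2 ⟨q3, q2⟩
    have bad : p - q ∉ cn A := by
      intro hm
      refine hAW _ hm ((hW _).2 ⟨by simp [p1, q1], by simp [p2, q2]⟩)
    rcases lt_or_gt_of_ne (hψ p hp) with hp0 | hp0 <;>
      rcases lt_or_gt_of_ne (hψ q hq) with hq0 | hq0
    · have := hadd _ (cn_neg.2 ((cn_smul hs.ne').2 hp)) _ (cn_neg.2 ((cn_smul ht.ne').2 hq))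
        (by simp only [map_neg, map_smul, smul_eq_mul]; nlinarith)
        (by simp only [map_neg, map_smul, smul_eq_mul]; nlinarith)
      rw [← neg_add, cn_neg] at this
      exact ((hcn _).1 this).1
    · have := hadd _ (cn_neg.2 hp) _ hq (by simpa using hp0) hq0
      rw [← cn_neg, neg_add, neg_neg, ← sub_eq_add_neg] at this
      exact absurd ((hcn _).1 this).1 bad
    · have := hadd _ hp _ (cn_neg.2 hq) hp0 (by simpa using hq0)
      rw [← sub_eq_add_neg] at this
      exact absurd ((hcn _).1 this).1 bad
    · have := hadd _ ((cn_smul hs.ne').2 hp) _ ((cn_smul ht.ne').2 hq)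
        (by simp only [map_smul, smul_eq_mul]; positivity)
        (by simp only [map_smul, smul_eq_mul]; positivity)
      exact ((hcn _).1 this).1
  · rw [mem_iff_rep_cn, cn_inter_projSet, LinearMap.mem_ker] at hx
    have h0 : α x.rep ≠ 0 := fun h => hAW _ hx.1 ((hW _).2 ⟨h, hx.2⟩)
    exact ⟨(α x.rep)⁻¹ • x.rep, by simp [h0], by simp [hx.2],
      (cn_smul (inv_ne_zero h0)).2 hx.1⟩

/-- The sections of the surgery. -/
theorem SC_section (hKa : Convex ℝ (KK α β A)) (hKb : Convex ℝ (KK β α A))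
    (hna : (KK α β A).Nonempty) (hnb : (KK β α A).Nonempty)
    (hW : ∀ v, v ∈ W ↔ α v = 0 ∧ β v = 0) (hAW : ∀ v ∈ cn A, v ∉ W)
    {S : Set (Projectivization ℝ V)} (hS : ∀ v, v ∈ cn S ↔ v ∈ SC α β A)
    (hαβ : α + β ≠ 0)
    {N : Submodule ℝ V} (hWN : W ≤ N) (v1 : V) (hv1 : v1 ∈ N) (hv1W : v1 ∉ W)
    (hN : ∀ v ∈ N, ∃ k : ℝ, v - k • v1 ∈ W)
    (h : (A ∩ projSet N).Nonempty ∧ IsProjConvex (A ∩ projSet N)) :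
    (S ∩ projSet N).Nonempty ∧ IsProjConvex (S ∩ projSet N) := by
  have hNc : ∀ v ∈ N, ∃ k : ℝ, α v = k * α v1 ∧ β v = k * β v1 := by
    intro v hv
    obtain ⟨k, hk⟩ := hN v hv
    refine ⟨k, ?_⟩
    rw [hW] at hk
    simp only [map_sub, map_smul, smul_eq_mul, sub_eq_zero] at hk
    exact hk
  rcases lt_or_ge (α v1 * β v1) 0 with hlt | hge
  · have : S ∩ projSet N = A ∩ projSet N := by
      apply set_ext_cn
      intro v
      rw [cn_inter_projSet, cn_inter_projSet, hS]
      refine and_congr_left fun hv => ?_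
      obtain ⟨k, e1, e2⟩ := hNc v hv
      constructor
      · rintro ⟨h0, (⟨-, h⟩ | ⟨h, p, hp, q, hq, e⟩)⟩
        · exact h
        · exfalso
          rw [e1, e2] at h
          have hk : k = 0 := by
            by_contra hk
            have : 0 < k ^ 2 := by positivity
            nlinarith
          apply h0
          rw [e, e1, e2, hk]
          simp
      · intro hv
        refine ⟨hv.1, Or.inl ⟨?_, hv⟩⟩
        have hk : k ≠ 0 := by
          rintro rfl
          exact hAW v hv ((hW v).2 ⟨by simpa using e1, by simpa using e2⟩)
        have : 0 < k ^ 2 := by positivity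
        rw [e1, e2]
        nlinarith
    rw [this]
    exact h
  · constructor
    · obtain ⟨p, hp⟩ := hna
      obtain ⟨q, hq⟩ := hnb
      set u := α v1 • p + β v1 • q with hu
      have e1 : α u = α v1 := by simp [hu, hp.1, hq.2.1]
      have e2 : β u = β v1 := by simp [hu, hp.2.1, hq.1]
      have hu0 : u ≠ 0 := by
        intro h
        rw [h, map_zero] at e1 e2
        exact hv1W ((hW _).2 ⟨e1.symm, e2.symm⟩)
      have huN : u ∈ N := by
        have : u - v1 ∈ W := (hW _).2 ⟨by simp [e1], by simp [e2]⟩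
        have := N.add_mem (hWN this) hv1
        simpa using this
      have : u ∈ cn (S ∩ projSet N) := by
        rw [cn_inter_projSet, hS]
        refine ⟨⟨hu0, Or.inr ⟨by rw [e1, e2]; exact hge, p, hp, q, hq, ?_⟩⟩, huN⟩
        rw [e1, e2]
      exact ⟨_, this.2⟩
    · rw [isProjConvex_iff]
      have key : ∀ v ∈ cn (S ∩ projSet N), v ∈ N ∧ v ≠ 0 ∧ 0 ≤ α v * β v ∧
          ∃ p ∈ KK α β A, ∃ q ∈ KK β α A, v = α v • p + β v • q := by
        intro v hv
        rw [cn_inter_projSet, hS] at hv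
        obtain ⟨⟨h0, h⟩, hvN⟩ := hv
        obtain ⟨k, e1, e2⟩ := hNc v hvN
        have h2 : 0 ≤ α v * β v := by
          rw [e1, e2]
          nlinarith [mul_nonneg (sq_nonneg k) hge]
        refine ⟨hvN, h0, h2, ?_⟩
        rcases h with h | h
        · linarith [h.1]
        · exact h.2
      refine ⟨α + β, hαβ, ?_, ?_⟩
      · intro v hv h
        obtain ⟨-, h0, h1, p, hp, q, hq, e⟩ := key v hv
        rw [LinearMap.add_apply] at h
        have e1 : α v = -β v := by linarith
        have e2 : β v * β v = 0 := by rw [e1] at h1; nlinarith [mul_self_nonneg (β v)]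
        have e2 : β v = 0 := by simpa using e2
        apply h0
        rw [e, e1, e2]; simp
      · intro u hu v hv hu0 hv0
        obtain ⟨uN, u0, u1, p, hp, q, hq, eu⟩ := key u hu
        obtain ⟨vN, v0, w1, p', hp', q', hq', ev⟩ := key v hv
        rw [LinearMap.add_apply] at hu0 hv0
        have pos : ∀ x y : ℝ, 0 < x + y → 0 ≤ x * y → 0 ≤ x ∧ 0 ≤ y := by
          intro x y h1 h2
          constructor <;> by_contra hcon <;> push Not at hcon <;> nlinarith
        obtain ⟨a1, a2⟩ := pos _ _ hu0 u1
        obtain ⟨b1, b2⟩ := pos _ _ hv0 w1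
        obtain ⟨p2, hp2, e1⟩ := comb_mem hKa hp hp' (s := α u) (t := α v) one_ne_zero
          (by simpa using a1) (by simpa using b1)
        obtain ⟨q2, hq2, e2⟩ := comb_mem hKb hq hq' (s := β u) (t := β v) one_ne_zero
          (by simpa using a2) (by simpa using b2)
        rw [cn_inter_projSet, hS]
        refine ⟨⟨?_, Or.inr ⟨?_, p2, hp2, q2, hq2, ?_⟩⟩, N.add_mem uN vN⟩
        · intro h
          have := congrArg (α + β) h
          simp only [map_add, map_zero, LinearMap.add_apply] at this
          linarith
        · rw [map_add, map_add]; positivity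
        · rw [map_add, map_add, ← e1, ← e2]
          conv_lhs => rw [eu, ev]
          abel

end Surgery

section Topology

variable {V : Type*} [NormedAddCommGroup V] [NormedSpace ℝ V] [FiniteDimensional ℝ V]
  {W : Submodule ℝ V} {A : Set (Projectivization ℝ V)} {α β : Module.Dual ℝ V}

theorem cn_closed (hA : IsClosed A) : IsClosed (cn A ∪ {0}) := by
  have : cn A ∪ {0} = (cn Aᶜ)ᶜ := by
    ext v
    rw [mem_compl_iff, cn_compl]
    simp only [mem_union, mem_singleton_iff]
    tauto
  rw [this]
  exact (isOpen_cn hA.isOpen_compl).isClosed_compl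

theorem KK_compact (hA : IsClosed A) (hAW : ∀ v ∈ cn A, ¬(α v = 0 ∧ β v = 0)) :
    IsCompact (KK α β A) := by
  have hα := α.continuous_of_finiteDimensional
  have hβ := β.continuous_of_finiteDimensional
  have h1 : IsCompact (Metric.sphere (0 : V) 1 ∩ ((cn A ∪ {0}) ∩ {v | β v = 0})) := by
    have : ProperSpace V := FiniteDimensional.proper_real V
    exact (isCompact_sphere (0 : V) 1).inter_right
      ((cn_closed hA).inter (isClosed_eq hβ continuous_const))
  have hmem : ∀ v ∈ Metric.sphere (0 : V) 1 ∩ ((cn A ∪ {0}) ∩ {v | β v = 0}),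
      v ∈ cn A ∧ β v = 0 ∧ α v ≠ 0 := by
    rintro v ⟨h1, h2 | h2, h3⟩
    · exact ⟨h2, h3, fun h => hAW v h2 ⟨h, h3⟩⟩
    · rw [mem_singleton_iff] at h2
      simp [h2] at h1
  have h2 : ContinuousOn (fun v => (α v)⁻¹ • v)
      (Metric.sphere (0 : V) 1 ∩ ((cn A ∪ {0}) ∩ {v | β v = 0})) := by
    apply ContinuousOn.smul _ continuousOn_id
    exact hα.continuousOn.inv₀ fun v hv => (hmem v hv).2.2
  convert h1.image_of_continuousOn h2 using 1
  ext v
  constructor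
  · rintro ⟨e1, e2, e3⟩
    have hn : ‖v‖ ≠ 0 := norm_ne_zero_iff.2 e3.1
    refine ⟨‖v‖⁻¹ • v, ⟨by simp [norm_smul, hn], Or.inl ((cn_smul (inv_ne_zero hn)).2 e3),
      by simp [e2]⟩, ?_⟩
    simp [e1, smul_smul, hn]
  · rintro ⟨w, hw, rfl⟩
    obtain ⟨a1, a2, a3⟩ := hmem w hw
    exact ⟨by simp [a3], by simp [a2], (cn_smul (inv_ne_zero a3)).2 a1⟩

theorem SC_closed (hA : IsClosed A) (hAW : ∀ v ∈ cn A, ¬(α v = 0 ∧ β v = 0))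
    (hna : (KK α β A).Nonempty) (hnb : (KK β α A).Nonempty)
    {S : Set (Projectivization ℝ V)} (hS : ∀ v, v ∈ cn S ↔ v ∈ SC α β A) : IsClosed S := by
  have hα := α.continuous_of_finiteDimensional
  have hβ := β.continuous_of_finiteDimensional
  have cKa := KK_compact (α := α) (β := β) hA hAW
  have cKb := KK_compact (α := β) (β := α) hA fun v hv h => hAW v hv h.symm
  have hcl : IsClosed {v : V | ∃ p ∈ KK α β A, ∃ q ∈ KK β α A, v = α v • p + β v • q} := by
    have hc := cKa.prod cKb
    have : CompactSpace (KK α β A ×ˢ KK β α A) := isCompact_iff_compactSpace.1 hc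
    have h1 : IsClosed {x : V × (KK α β A ×ˢ KK β α A) |
        x.1 = α x.1 • x.2.1.1 + β x.1 • x.2.1.2} := isClosed_eq (by fun_prop) (by fun_prop)
    have h2 := isClosedMap_fst_of_compactSpace _ h1
    convert h2 using 1
    ext v
    constructor
    · rintro ⟨p, hp, q, hq, e⟩
      exact ⟨(v, ⟨(p, q), ⟨hp, hq⟩⟩), e, rfl⟩
    · rintro ⟨⟨w, ⟨⟨p, q⟩, ⟨hp, hq⟩⟩⟩, e, rfl⟩
      exact ⟨p, hp, q, hq, e⟩
  have hcl1 : IsClosed {v : V | α v * β v ≤ 0} :=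
    isClosed_le (by fun_prop) continuous_const
  have hcl2 : IsClosed {v : V | 0 ≤ α v * β v} :=
    isClosed_le continuous_const (by fun_prop)
  have htot := ((cn_closed hA).inter hcl1).union (hcl.inter hcl2)
  rw [← isOpen_compl_iff]
  apply isOpen_of_cn
  convert (isOpen_ne (x := (0 : V))).inter htot.isOpen_compl using 1
  ext v
  rw [cn_compl, hS]
  refine and_congr_right fun hv0 => not_congr ?_
  constructor
  · rintro ⟨-, (⟨h1, h2⟩ | ⟨h1, h2⟩)⟩
    · exact Or.inl ⟨Or.inl h2, h1.le⟩
    · exact Or.inr ⟨h2, h1⟩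
  · rintro (⟨h1 | h1, h2⟩ | ⟨h1, h2⟩)
    · refine ⟨hv0, ?_⟩
      rcases (show α v * β v ≤ 0 from h2).lt_or_eq with h | h
      · exact Or.inl ⟨h, h1⟩
      · refine Or.inr ⟨h.ge, ?_⟩
        obtain ⟨p0, hp0⟩ := hna
        obtain ⟨q0, hq0⟩ := hnb
        rcases mul_eq_zero.1 h with h | h
        · have h' : β v ≠ 0 := fun h' => hAW v h1 ⟨h, h'⟩
          exact ⟨p0, hp0, (β v)⁻¹ • v, ⟨by simp [h'], by simp [h],
            (cn_smul (inv_ne_zero h')).2 h1⟩, by simp [h, smul_smul, h']⟩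
        · have h' : α v ≠ 0 := fun h' => hAW v h1 ⟨h', h⟩
          exact ⟨(α v)⁻¹ • v, ⟨by simp [h'], by simp [h],
            (cn_smul (inv_ne_zero h')).2 h1⟩, q0, hq0, by simp [h, smul_smul, h']⟩
    · exact absurd h1 hv0
    · exact ⟨hv0, Or.inr ⟨h2, h1⟩⟩

theorem KK_interval (hKa : Convex ℝ (KK α β A)) (hna : (KK α β A).Nonempty)
    (hA : IsClosed A) (hAW : ∀ v ∈ cn A, ¬(α v = 0 ∧ β v = 0)) (ρ : Module.Dual ℝ V) :
    ∃ t0 t1 : ℝ, t0 ≤ t1 ∧ ∀ t, (t0 ≤ t ∧ t ≤ t1) ↔ ∃ p ∈ KK α β A, ρ p = t := by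
  have hρ := ρ.continuous_of_finiteDimensional
  have c := KK_compact (α := α) (β := β) hA hAW
  obtain ⟨p0, hp0, h0⟩ := c.exists_isMinOn hna hρ.continuousOn
  obtain ⟨p1, hp1, h1⟩ := c.exists_isMaxOn hna hρ.continuousOn
  refine ⟨ρ p0, ρ p1, h0 hp1, fun t => ⟨?_, ?_⟩⟩
  · intro ht
    have hc : Convex ℝ (ρ '' KK α β A) := hKa.linear_image ρ
    have := hc.ordConnected.out ⟨p0, hp0, rfl⟩ ⟨p1, hp1, rfl⟩ ht
    exact this
  · rintro ⟨p, hp, rfl⟩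
    exact ⟨h0 hp, h1 hp⟩

theorem prop_aux1 {p q : Prop} : (¬p ∧ ¬(¬p ∧ q)) ↔ (¬p ∧ ¬q) := by tauto

theorem prop_aux2 {p q : Prop} : ¬(¬p ∧ ¬q) ↔ (p ∨ q) := by tauto

set_option maxHeartbeats 4000000 in
theorem SC_proj (hKa : Convex ℝ (KK α β A)) (hKb : Convex ℝ (KK β α A))
    (hna : (KK α β A).Nonempty) (hnb : (KK β α A).Nonempty)
    (hA : IsClosed A) (hAW : ∀ v ∈ cn A, ¬(α v = 0 ∧ β v = 0))
    {S : Set (Projectivization ℝ V)} (hS : ∀ v, v ∈ cn S ↔ v ∈ SC α β A)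
    {T : Submodule ℝ V} {e : V} {ρ : Module.Dual ℝ V}
    (heα : α e = 0) (heβ : β e = 0) (heρ : ρ e = 1)
    (hT : ∀ v, v ∈ T ↔ α v = 0 ∧ β v = 0 ∧ ρ v = 0)
    {μ : Module.Dual ℝ (V ⧸ T)} (hμe : 0 < μ (T.mkQ e))
    (hμ : ∀ v ∈ cn (projImage T A)ᶜ, μ v ≠ 0)
    (hadd : ∀ u ∈ cn (projImage T A)ᶜ, ∀ v ∈ cn (projImage T A)ᶜ, 0 < μ u → 0 < μ v →
      u + v ∈ cn (projImage T A)ᶜ)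
    (hop : IsOpen (projImage T A)ᶜ) :
    IsOpen (projImage T S)ᶜ ∧ IsProjConvex (projImage T S)ᶜ := by
  have hAW' : ∀ v ∈ cn A, ¬(β v = 0 ∧ α v = 0) := fun v hv h => hAW v hv h.symm
  obtain ⟨t0, t1, h01, hta⟩ := KK_interval hKa hna hA hAW ρ
  obtain ⟨w0, w1, hw01, htb⟩ := KK_interval hKb hnb hA hAW' ρ
  have : IsClosed (T : Set V) := T.closed_of_finiteDimensional
  obtain ⟨p, hp⟩ := hna
  obtain ⟨q, hq⟩ := hnb
  set va := p - ρ p • e with hva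
  set vb := q - ρ q • e with hvb
  have va1 : α va = 1 := by simp [hva, hp.1, heα]
  have va2 : β va = 0 := by simp [hva, hp.2.1, heβ]
  have va3 : ρ va = 0 := by simp [hva, heρ]
  have vb1 : β vb = 1 := by simp [hvb, hq.1, heβ]
  have vb2 : α vb = 0 := by simp [hvb, hq.2.1, heα]
  have vb3 : ρ vb = 0 := by simp [hvb, heρ]
  have hop' := isOpen_cn hop
  have cμ : Continuous μ := μ.continuous_of_finiteDimensional
  -- equality modulo `T`
  have hmk : ∀ u v : V, T.mkQ u = T.mkQ v ↔ α u = α v ∧ β u = β v ∧ ρ u = ρ v := by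
    intro u v
    rw [← sub_eq_zero, ← map_sub, Submodule.mkQ_apply, Submodule.Quotient.mk_eq_zero, hT]
    simp [sub_eq_zero]
  let pt : ℝ → ℝ → ℝ → V ⧸ T := fun s s' r => T.mkQ (s • va + s' • vb + r • e)
  have ptα : ∀ s s' r : ℝ, α (s • va + s' • vb + r • e) = s := by
    intro s s' r; simp [va1, vb2, heα]
  have ptβ : ∀ s s' r : ℝ, β (s • va + s' • vb + r • e) = s' := by
    intro s s' r; simp [va2, vb1, heβ]
  have ptρ : ∀ s s' r : ℝ, ρ (s • va + s' • vb + r • e) = r := by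
    intro s s' r; simp [va3, vb3, heρ]
  have hpt : ∀ v s s' r, T.mkQ v = pt s s' r ↔ α v = s ∧ β v = s' ∧ ρ v = r := by
    intro v s s' r
    rw [hmk, ptα, ptβ, ptρ]
  have pt_add : ∀ s s' r x x' y, pt (s + x) (s' + x') (r + y) = pt s s' r + pt x x' y := by
    intro s s' r x x' y
    simp only [pt, ← map_add]
    congr 1
    module
  have pt_smul : ∀ c s s' r, pt (c * s) (c * s') (c * r) = c • pt s s' r := by
    intro c s s' r
    simp only [pt, ← map_smul]
    congr 1
    module
  have pt_neg : ∀ s s' r, pt (-s) (-s') (-r) = -pt s s' r := by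
    intro s s' r
    simp only [pt, ← map_neg]
    congr 1
    module
  have pt_zero : ∀ s s' r, pt s s' r = 0 ↔ s = 0 ∧ s' = 0 ∧ r = 0 := by
    intro s s' r
    rw [eq_comm, ← map_zero T.mkQ, hpt]
    simp [eq_comm]
  let U : ℝ → ℝ → ℝ → Prop := fun s s' r =>
    pt s s' r ∈ cn (projImage T A)ᶜ ∧ 0 < μ (pt s s' r)
  have U_or : ∀ s s' r, pt s s' r ∈ cn (projImage T A)ᶜ ↔ U s s' r ∨ U (-s) (-s') (-r) := by
    intro s s' r
    simp only [U]
    rw [pt_neg, cn_neg, map_neg]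
    constructor
    · intro h
      rcases lt_or_gt_of_ne (hμ _ h) with h' | h'
      · exact Or.inr ⟨h, by linarith⟩
      · exact Or.inl ⟨h, h'⟩
    · rintro (h | h) <;> exact h.1
  have img : ∀ s s' r, pt s s' r ∈ cn (projImage T A)ᶜ ↔
      ¬(s = 0 ∧ s' = 0 ∧ r = 0) ∧ ¬∃ v ∈ cn A, α v = s ∧ β v = s' ∧ ρ v = r := by
    intro s s' r
    rw [cn_compl, cn_projImage]
    simp only [hpt, ne_eq, pt_zero]
    exact prop_aux1
  have imgS : ∀ s s' r, pt s s' r ∈ cn (projImage T S)ᶜ ↔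
      ¬(s = 0 ∧ s' = 0 ∧ r = 0) ∧ ¬∃ v ∈ SC α β A, α v = s ∧ β v = s' ∧ ρ v = r := by
    intro s s' r
    rw [cn_compl, cn_projImage]
    simp only [hpt, ne_eq, pt_zero, hS]
    exact prop_aux1
  have Uin : ∀ {s s' r}, ¬(U s s' r ∨ U (-s) (-s') (-r)) ↔
      (s = 0 ∧ s' = 0 ∧ r = 0) ∨ ∃ v ∈ cn A, α v = s ∧ β v = s' ∧ ρ v = r := by
    intro s s' r
    rw [← U_or, img]
    exact prop_aux2
  have aUin : ∀ t, ¬(U 1 0 t ∨ U (-1) 0 (-t)) ↔ (t0 ≤ t ∧ t ≤ t1) := by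
    intro t
    have := Uin (s := 1) (s' := 0) (r := t)
    rw [neg_zero] at this
    rw [this, hta]
    constructor
    · rintro (h | ⟨v, hv, h1, h2, h3⟩)
      · exact absurd h.1 one_ne_zero
      · exact ⟨v, ⟨h1, h2, hv⟩, h3⟩
    · rintro ⟨v, ⟨h1, h2, hv⟩, h3⟩
      exact Or.inr ⟨v, hv, h1, h2, h3⟩
  have bUin : ∀ t, ¬(U 0 1 t ∨ U 0 (-1) (-t)) ↔ (w0 ≤ t ∧ t ≤ w1) := by
    intro t
    have := Uin (s := 0) (s' := 1) (r := t)
    rw [neg_zero] at this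
    rw [this, htb]
    constructor
    · rintro (h | ⟨v, hv, h1, h2, h3⟩)
      · exact absurd h.2.1 one_ne_zero
      · exact ⟨v, ⟨h2, h1, hv⟩, h3⟩
    · rintro ⟨v, ⟨h1, h2, hv⟩, h3⟩
      exact Or.inr ⟨v, hv, h2, h1, h3⟩
  have core := core_real (U := U) (t0 := t0) (t1 := t1) (w0 := w0) (w1 := w1)
    (by
      rintro s s' r x x' y ⟨h1, h2⟩ ⟨h3, h4⟩
      simp only [U]
      rw [pt_add, map_add]
      exact ⟨hadd _ h1 _ h3 h2 h4, by linarith⟩)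
    (by
      rintro c s s' r hc ⟨h1, h2⟩
      simp only [U]
      rw [pt_smul, map_smul]
      exact ⟨(cn_smul hc.ne').2 h1, by rw [smul_eq_mul]; positivity⟩)
    (by
      rintro ⟨h, -⟩
      exact h.1 ((pt_zero _ _ _).2 ⟨rfl, rfl, rfl⟩))
    (by
      refine ⟨(img _ _ _).2 ⟨by simp, ?_⟩, ?_⟩
      · rintro ⟨v, hv, h1, h2, -⟩
        exact hAW v hv ⟨h1, h2⟩
      · simpa [pt] using hμe)
    (by
      rintro s s' r ⟨h1, h2⟩
      have hc : Continuous fun δ : ℝ => pt s s' (r - δ) := by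
        refine T.continuous_mkQ.comp ?_
        fun_prop
      have ho : IsOpen {δ : ℝ | pt s s' (r - δ) ∈ cn (projImage T A)ᶜ ∧
          0 < μ (pt s s' (r - δ))} :=
        (hop'.preimage hc).inter (isOpen_lt continuous_const (cμ.comp hc))
      have hm := ho.mem_nhds (show (0 : ℝ) ∈ _ by simpa using ⟨h1, h2⟩)
      obtain ⟨ε, hε, hball⟩ := Metric.mem_nhds_iff.1 hm
      refine ⟨ε / 2, by positivity, hball ?_⟩
      rw [Metric.mem_ball, Real.dist_eq, sub_zero, abs_of_pos (by positivity)]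
      linarith)
    h01 hw01
    (fun t h h' => not_or.1 ((aUin t).2 ⟨h, h'⟩))
    (fun t h => by
      by_contra hcon
      have := (aUin t).1 hcon
      rcases h with h | h <;> linarith)
    (fun t h h' => not_or.1 ((bUin t).2 ⟨h, h'⟩))
    (fun t h => by
      by_contra hcon
      have := (bUin t).1 hcon
      rcases h with h | h <;> linarith)
  -- interpolation
  have interp : ∀ s s' r : ℝ, 0 ≤ s → 0 ≤ s' → t0 * s + w0 * s' ≤ r → r ≤ t1 * s + w1 * s' →
      ∃ t, (t0 ≤ t ∧ t ≤ t1) ∧ ∃ w, (w0 ≤ w ∧ w ≤ w1) ∧ r = s * t + s' * w := by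
    intro s s' r hs hs' h1 h2
    rcases (h1.trans h2).eq_or_lt with h | h
    · exact ⟨t0, ⟨le_rfl, h01⟩, w0, ⟨le_rfl, hw01⟩, by linarith⟩
    · set D := t1 * s + w1 * s' - (t0 * s + w0 * s') with hD
      have hD0 : 0 < D := by linarith
      set θ := (r - (t0 * s + w0 * s')) / D with hθ
      have hθ0 : 0 ≤ θ := div_nonneg (by linarith) hD0.le
      have hθ1 : θ ≤ 1 := by rw [hθ, div_le_one hD0]; linarith
      have hθD : θ * D = r - (t0 * s + w0 * s') := by rw [hθ]; field_simp
      refine ⟨t0 + θ * (t1 - t0), ⟨?_, ?_⟩, w0 + θ * (w1 - w0), ⟨?_, ?_⟩, ?_⟩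
      · nlinarith
      · nlinarith
      · nlinarith
      · nlinarith
      · rw [hD] at hθD; linear_combination -hθD
  have hSC : ∀ s s' r, ¬(s = 0 ∧ s' = 0 ∧ r = 0) →
      ((∃ v ∈ SC α β A, α v = s ∧ β v = s' ∧ ρ v = r) ↔
      ((s * s' < 0 ∧ ¬U s s' r ∧ ¬U (-s) (-s') (-r)) ∨
      (0 ≤ s ∧ 0 ≤ s' ∧ t0 * s + w0 * s' ≤ r ∧ r ≤ t1 * s + w1 * s') ∨
      (s ≤ 0 ∧ s' ≤ 0 ∧ t1 * s + w1 * s' ≤ r ∧ r ≤ t0 * s + w0 * s'))) := by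
    intro s s' r hne
    have build : ∀ t w, (t0 ≤ t ∧ t ≤ t1) → (w0 ≤ w ∧ w ≤ w1) → r = s * t + s' * w →
        0 ≤ s * s' → ∃ v ∈ SC α β A, α v = s ∧ β v = s' ∧ ρ v = r := by
      intro t w ht hw hr hss
      obtain ⟨p, hp, rfl⟩ := (hta t).1 ht
      obtain ⟨q, hq, rfl⟩ := (htb w).1 hw
      have e1 : α (s • p + s' • q) = s := by simp [hp.1, hq.2.1]
      have e2 : β (s • p + s' • q) = s' := by simp [hp.2.1, hq.1]
      have e3 : ρ (s • p + s' • q) = r := by simp [hr]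
      refine ⟨s • p + s' • q, ⟨?_, Or.inr ⟨by rwa [e1, e2], p, hp, q, hq, by rw [e1, e2]⟩⟩,
        e1, e2, e3⟩
      intro h
      rw [h, map_zero] at e1 e2 e3
      exact hne ⟨e1.symm, e2.symm, e3.symm⟩
    constructor
    · rintro ⟨v, ⟨hv0, hv⟩, rfl, rfl, rfl⟩
      rcases hv with ⟨h1, h2⟩ | ⟨h1, p, hp, q, hq, e⟩
      · exact Or.inl ⟨h1, not_or.1 (Uin.2 (Or.inr ⟨v, h2, rfl, rfl, rfl⟩))⟩
      · right
        obtain ⟨a1, a2⟩ := (hta _).2 ⟨p, hp, rfl⟩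
        obtain ⟨b1, b2⟩ := (htb _).2 ⟨q, hq, rfl⟩
        have er : ρ v = α v * ρ p + β v * ρ q := by
          conv_lhs => rw [e]
          simp
        rw [er]
        rcases mul_nonneg_iff.1 h1 with ⟨g1, g2⟩ | ⟨g1, g2⟩
        · left
          exact ⟨g1, g2, by nlinarith, by nlinarith⟩
        · right
          exact ⟨g1, g2, by nlinarith, by nlinarith⟩
    · rintro (⟨h1, h2, h3⟩ | ⟨h1, h2, h3, h4⟩ | ⟨h1, h2, h3, h4⟩)
      · rcases Uin.1 (not_or.2 ⟨h2, h3⟩) with h | ⟨v, hv, e1, e2, e3⟩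
        · exact absurd h hne
        · exact ⟨v, ⟨hv.1, Or.inl ⟨by rwa [e1, e2], hv⟩⟩, e1, e2, e3⟩
      · obtain ⟨t, ht, w, hw, hr⟩ := interp s s' r h1 h2 h3 h4
        exact build t w ht hw hr (mul_nonneg h1 h2)
      · obtain ⟨t, ht, w, hw, hr⟩ := interp (-s) (-s') (-r) (by linarith) (by linarith)
          (by linarith) (by linarith)
        exact build t w ht hw (by linarith) (mul_nonneg_of_nonpos_of_nonpos h1 h2)
  let αE : Module.Dual ℝ (V ⧸ T) := T.liftQ α fun v hv => ((hT v).1 hv).1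
  let βE : Module.Dual ℝ (V ⧸ T) := T.liftQ β fun v hv => ((hT v).1 hv).2.1
  let ρE : Module.Dual ℝ (V ⧸ T) := T.liftQ ρ fun v hv => ((hT v).1 hv).2.2
  have cα : Continuous αE := αE.continuous_of_finiteDimensional
  have cβ : Continuous βE := βE.continuous_of_finiteDimensional
  have cρ : Continuous ρE := ρE.continuous_of_finiteDimensional
  have ptE : ∀ z, z = pt (αE z) (βE z) (ρE z) := by
    intro z
    obtain ⟨v, rfl⟩ := T.mkQ_surjective z
    rw [hpt]
    exact ⟨rfl, rfl, rfl⟩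
  let UU : Set (V ⧸ T) := {z | (z ∈ cn (projImage T A)ᶜ ∧ 0 < μ z) ∧
    t0 * αE z + w0 * βE z < ρE z ∧ t1 * αE z + w1 * βE z < ρE z}
  have main : ∀ z, z ∈ cn (projImage T S)ᶜ ↔ z ∈ UU ∨ -z ∈ UU := by
    intro z
    have e1 : z ∈ UU ↔ U (αE z) (βE z) (ρE z) ∧
        t0 * αE z + w0 * βE z < ρE z ∧ t1 * αE z + w1 * βE z < ρE z := by
      simp only [U, ← ptE z]
      rfl
    have e2 : -z ∈ UU ↔ U (-αE z) (-βE z) (-ρE z) ∧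
        t0 * -αE z + w0 * -βE z < -ρE z ∧ t1 * -αE z + w1 * -βE z < -ρE z := by
      simp only [U, pt_neg, ← ptE z]
      simp only [UU, mem_ofPred_eq, map_neg]
    rw [e1, e2, ← core]
    conv_lhs => rw [ptE z]
    rw [imgS]
    by_cases hz : αE z = 0 ∧ βE z = 0 ∧ ρE z = 0
    · rw [hz.1, hz.2.1, hz.2.2]
      simp
    · rw [hSC _ _ _ hz]
      exact ⟨fun h => h.2, fun h => ⟨hz, h⟩⟩
  have UUo : IsOpen UU := by
    refine (hop'.inter (isOpen_lt continuous_const cμ)).inter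
      ((isOpen_lt (by fun_prop) cρ).inter (isOpen_lt (by fun_prop) cρ))
  constructor
  · apply isOpen_of_cn
    have : cn (projImage T S)ᶜ = UU ∪ Neg.neg ⁻¹' UU := by
      ext z
      exact main z
    rw [this]
    exact UUo.union (UUo.preimage continuous_neg)
  · rw [isProjConvex_iff]
    refine ⟨μ, ?_, ?_, ?_⟩
    · rintro rfl
      simp at hμe
    · intro v hv
      rcases (main v).1 hv with h | h
      · exact h.1.2.ne'
      · have := h.1.2
        rw [map_neg] at this
        linarith
    · have pos : ∀ v ∈ cn (projImage T S)ᶜ, 0 < μ v → v ∈ UU := by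
        intro v hv h0
        rcases (main v).1 hv with h | h
        · exact h
        · have := h.1.2
          rw [map_neg] at this
          linarith
      intro u hu v hv hu0 hv0
      obtain ⟨⟨a1, a2⟩, a3, a4⟩ := pos u hu hu0
      obtain ⟨⟨b1, b2⟩, b3, b4⟩ := pos v hv hv0
      refine (main _).2 (Or.inl ⟨⟨hadd _ a1 _ b1 a2 b2, ?_⟩, ?_, ?_⟩)
      · rw [map_add]; linarith
      · rw [map_add, map_add, map_add]; linarith
      · rw [map_add, map_add, map_add]; linarith

end Topology

section Assembly

theorem split_of_finrank {V : Type*} [AddCommGroup V] [Module ℝ V] [FiniteDimensional ℝ V]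
    {T W : Submodule ℝ V} (hTW : T ≤ W) (hf : finrank ℝ W = finrank ℝ T + 1)
    {e : V} (he : e ∈ W) (heT : e ∉ T) : ∀ v ∈ W, ∃ k : ℝ, v - k • e ∈ T := by
  have hle : T ⊔ Submodule.span ℝ {e} ≤ W :=
    sup_le hTW ((Submodule.span_singleton_le_iff_mem _ _).2 he)
  have hlt : T < T ⊔ Submodule.span ℝ {e} := by
    refine lt_of_le_of_ne le_sup_left fun h => heT ?_
    rw [h]
    exact Submodule.mem_sup_right (Submodule.mem_span_singleton_self e)
  have hlt' := Submodule.finrank_lt_finrank_of_lt hlt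
  have heq := Submodule.eq_of_le_of_finrank_le hle (by omega)
  intro v hv
  rw [← heq, Submodule.mem_sup] at hv
  obtain ⟨y, hy, z, hz, rfl⟩ := hv
  obtain ⟨k, rfl⟩ := Submodule.mem_span_singleton.1 hz
  exact ⟨k, by simpa using hy⟩

theorem exists_mem_notMem {V : Type*} [AddCommGroup V] [Module ℝ V] [FiniteDimensional ℝ V]
    {T W : Submodule ℝ V} (hTW : T ≤ W) (hf : finrank ℝ W = finrank ℝ T + 1) :
    ∃ e ∈ W, e ∉ T := by
  have hlt : T < W := lt_of_le_of_ne hTW fun h => by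
    rw [h] at hf
    omega
  exact SetLike.exists_of_lt hlt

theorem coords {Q : Type*} [AddCommGroup Q] [Module ℝ Q] [FiniteDimensional ℝ Q]
    (hQ : finrank ℝ Q = 2) (a b : Projectivization ℝ Q) (hab : a ≠ b) (φ : Module.Dual ℝ Q)
    (ha : φ a.rep ≠ 0) (hb : φ b.rep ≠ 0) :
    ∃ (α β : Module.Dual ℝ Q) (v1 v2 : Q), α v1 = 1 ∧ β v1 = 0 ∧ α v2 = 0 ∧ β v2 = 1 ∧
      (∀ z, z = α z • v1 + β z • v2) ∧ v1 ∈ cn {a} ∧ v2 ∈ cn {b} ∧ ∀ z, φ z = α z + β z := by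
  have h1 : ((φ a.rep)⁻¹ • a.rep) ∈ cn {a} :=
    (cn_smul (inv_ne_zero ha)).2 (mem_iff_rep_cn.1 rfl)
  have h2 : ((φ b.rep)⁻¹ • b.rep) ∈ cn {b} :=
    (cn_smul (inv_ne_zero hb)).2 (mem_iff_rep_cn.1 rfl)
  have e1 : φ ((φ a.rep)⁻¹ • a.rep) = 1 := by simp [ha]
  have e2 : φ ((φ b.rep)⁻¹ • b.rep) = 1 := by simp [hb]
  generalize (φ a.rep)⁻¹ • a.rep = v1 at h1 e1
  generalize (φ b.rep)⁻¹ • b.rep = v2 at h2 e2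
  have hli : LinearIndependent ℝ ![v1, v2] := by
    rw [LinearIndependent.pair_iff]
    intro s t hst
    by_contra hcon
    have hsum : s + t = 0 := by
      have := congrArg φ hst
      simpa [e1, e2] using this
    have hs : s ≠ 0 := fun h => hcon ⟨h, by linarith⟩
    have ht : t = -s := by linarith
    have hv : v1 = v2 := by
      rw [ht, neg_smul, ← sub_eq_add_neg, ← smul_sub, smul_eq_zero] at hst
      exact sub_eq_zero.1 (hst.resolve_left hs)
    subst hv
    obtain ⟨g, g1⟩ := h1
    obtain ⟨g', g2⟩ := h2
    exact hab (g1.symm.trans g2)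
  let B := basisOfLinearIndependentOfCardEqFinrank hli (by simp [hQ])
  have hB : (B : Fin 2 → Q) = ![v1, v2] := coe_basisOfLinearIndependentOfCardEqFinrank hli _
  have hB0 : B 0 = v1 := by rw [hB]; rfl
  have hB1 : B 1 = v2 := by rw [hB]; rfl
  have hsp : ∀ z, z = B.coord 0 z • v1 + B.coord 1 z • v2 := by
    intro z
    have := B.sum_repr z
    rw [Fin.sum_univ_two, hB0, hB1] at this
    exact this.symm
  refine ⟨B.coord 0, B.coord 1, v1, v2, ?_, ?_, ?_, ?_, hsp, h1, h2, ?_⟩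
  · rw [← hB0]; simp
  · rw [← hB0]; simp
  · rw [← hB1]; simp
  · rw [← hB1]; simp
  · intro z
    conv_lhs => rw [hsp z]
    simp [e1, e2]

theorem mem_cn_iff_exists {Q : Type*} [AddCommGroup Q] [Module ℝ Q]
    {X : Set (Projectivization ℝ Q)} {z : Q} (hz : z ≠ 0) :
    (∃ y ∈ X, z ∈ y.submodule) ↔ z ∈ cn X := by
  constructor
  · rintro ⟨y, hy, h⟩
    rw [mem_submodule_iff hz] at h
    exact ⟨hz, h ▸ hy⟩
  · rintro ⟨h, h'⟩
    exact ⟨_, h', (mem_submodule_iff hz).2 rfl⟩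

theorem assemble_convexConcave {V : Type*} [NormedAddCommGroup V] [NormedSpace ℝ V]
    [FiniteDimensional ℝ V] {W : Submodule ℝ V} {A S : Set (Projectivization ℝ V)}
    {α β : Module.Dual ℝ V}
    (hA : IsLConvexConcave W A)
    (hKa : Convex ℝ (KK α β A)) (hKb : Convex ℝ (KK β α A))
    (hna : (KK α β A).Nonempty) (hnb : (KK β α A).Nonempty)
    (hW : ∀ v, v ∈ W ↔ α v = 0 ∧ β v = 0) (hAW : ∀ v ∈ cn A, v ∉ W)
    (hS : ∀ v, v ∈ cn S ↔ v ∈ SC α β A) (hSW : ∀ x ∈ S, x.rep ∉ W) (hαβ : α + β ≠ 0) :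
    IsLConvexConcave W S := by
  have hAW' : ∀ v ∈ cn A, ¬(α v = 0 ∧ β v = 0) := fun v hv h => hAW v hv ((hW v).2 h)
  refine ⟨SC_closed hA.1 hAW' hna hnb hS, hSW, ?_, ?_⟩
  · intro N hWN hN
    obtain ⟨v1, hv1, hv1W⟩ := exists_mem_notMem hWN hN
    exact SC_section hKa hKb hna hnb hW hAW hS hαβ hWN v1 hv1 hv1W
      (split_of_finrank hWN hN hv1 hv1W) (hA.2.2.1 N hWN hN)
  · intro T hTW hT
    obtain ⟨hop, hcv⟩ := hA.2.2.2 T hTW hT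
    obtain ⟨μ, -, hμ, hadd⟩ := isProjConvex_iff.1 hcv
    obtain ⟨e0, he0, he0T⟩ := exists_mem_notMem hTW hT.symm
    have hq : ∀ e ∈ W, e ∉ T → T.mkQ e ∈ cn (projImage T A)ᶜ := by
      intro e he heT
      rw [cn_compl, cn_projImage]
      have h0 : T.mkQ e ≠ 0 := by simpa using heT
      refine ⟨h0, ?_⟩
      rintro ⟨-, v, hv, h⟩
      apply hAW v hv
      rw [← sub_eq_zero, ← map_sub, Submodule.mkQ_apply, Submodule.Quotient.mk_eq_zero] at h
      have := W.add_mem (hTW h) he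
      simpa using this
    obtain ⟨e, he, heT, hpos⟩ : ∃ e ∈ W, e ∉ T ∧ 0 < μ (T.mkQ e) := by
      rcases lt_or_gt_of_ne (hμ _ (hq e0 he0 he0T)) with h | h
      · refine ⟨-e0, W.neg_mem he0, fun h' => he0T (by simpa using h'), ?_⟩
        rw [map_neg, map_neg]
        linarith
      · exact ⟨e0, he0, he0T, h⟩
    obtain ⟨f, hf, hfT⟩ := Submodule.exists_le_ker_of_notMem heT
    have hf' : f e ≠ 0 := hf
    have hfT' : ∀ v ∈ T, f v = 0 := fun v hv => hfT hv
    let ρ : Module.Dual ℝ V := (f e)⁻¹ • f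
    have hρe : ρ e = 1 := by simp [ρ, hf']
    have hρT : ∀ v ∈ T, ρ v = 0 := fun v hv => by simp [ρ, hfT' v hv]
    have hTT : ∀ v, v ∈ T ↔ α v = 0 ∧ β v = 0 ∧ ρ v = 0 := by
      intro v
      constructor
      · intro hv
        have := (hW v).1 (hTW hv)
        exact ⟨this.1, this.2, hρT v hv⟩
      · rintro ⟨h1, h2, h3⟩
        obtain ⟨k, hk⟩ := split_of_finrank hTW hT.symm he heT v ((hW v).2 ⟨h1, h2⟩)
        have := hρT _ hk
        rw [map_sub, map_smul, h3, hρe] at this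
        have hk0 : k = 0 := by simpa using this
        simpa [hk0] using hk
    exact SC_proj hKa hKb hna hnb hA.1 hAW' hS ((hW e).1 he).1 ((hW e).1 he).2 hρe hTT hpos
      hμ hadd hop

theorem finrank_ker_eq {V : Type*} [AddCommGroup V] [Module ℝ V] [FiniteDimensional ℝ V]
    {α : Module.Dual ℝ V} {v : V} (hv : α v = 1) :
    finrank ℝ (LinearMap.ker α) + 1 = finrank ℝ V := by
  have hs : Function.Surjective α := fun t => ⟨t • v, by simp [hv]⟩
  have h := LinearMap.finrank_range_add_finrank_ker α
  rw [LinearMap.range_eq_top.2 hs, finrank_top, Module.finrank_self] at h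
  omega

end Assembly

/-- For an `L`-convex-concave set `A ⊆ ℝPⁿ` with `dim L = n − 2`, a
closed arc `[a,b]` (with distinct endpoints `a, b`) of the projective line `ℝPⁿ/L`
parameterizing the hyperplanes through `L`, and a point `c ∉ [a,b]`, the surgery
`S_{[a,b]}(A)` — replacing `A` over the arc `[a,b]` by the convex hull of
`(A ∩ Γ_a) ∪ (A ∩ Γ_b)` taken in the affine chart `ℝPⁿ ∖ Γ_c` — does not depend on
the choice of `c`, and is again `L`-convex-concave. -/
theorem statement15 (n : ℕ) (hn : 2 ≤ n) (W : Submodule ℝ (Vec n))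
    (hW : finrank ℝ W = n - 1)
    (A : Set (Pt n)) (hA : IsLConvexConcave W A)
    (a b : Projectivization ℝ (Vec n ⧸ W)) (hab : a ≠ b)
    (Arc : Set (Projectivization ℝ (Vec n ⧸ W)))
    (hArcCl : IsClosed Arc) (hArcConn : IsConnected Arc)
    (haArc : a ∈ Arc) (hbArc : b ∈ Arc)
    (hArcFr : frontier Arc = {a, b})
    (c c' : Projectivization ℝ (Vec n ⧸ W)) (hc : c ∉ Arc) (hc' : c' ∉ Arc)
    (φ φ' : Module.Dual ℝ (Vec n))
    (hφ : LinearMap.ker φ = c.submodule.comap W.mkQ)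
    (hφ' : LinearMap.ker φ' = c'.submodule.comap W.mkQ) :
    surgery W a b Arc φ A = surgery W a b Arc φ' A ∧
    IsLConvexConcave W (surgery W a b Arc φ A) := by
  have hVn : finrank ℝ (Vec n) = n + 1 := by simp
  have hQ2 : finrank ℝ (Vec n ⧸ W) = 2 := by
    have := W.finrank_quotient_add_finrank
    omega
  have hWcl : IsClosed (W : Set (Vec n)) := W.closed_of_finiteDimensional
  have hAW : ∀ v ∈ cn A, v ∉ W := by
    rintro v ⟨hv0, hv⟩ hvW
    obtain ⟨k, hk⟩ := Projectivization.exists_smul_eq_mk_rep ℝ v hv0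
    apply hA.2.1 _ hv
    rw [← hk]
    exact W.smul_mem _ hvW
  -- functionals attached to the points outside of the arc
  have key : ∀ (c : Projectivization ℝ (Vec n ⧸ W)) (φ : Module.Dual ℝ (Vec n)), c ∉ Arc →
      LinearMap.ker φ = c.submodule.comap W.mkQ →
      ∃ φQ : Module.Dual ℝ (Vec n ⧸ W), (∀ v, φQ (W.mkQ v) = φ v) ∧
        ∀ z, φQ z = 0 → z ∉ cn Arc := by
    intro c φ hc hφ
    have hm : ∀ v, φ v = 0 ↔ W.mkQ v ∈ c.submodule := by
      intro v
      rw [← LinearMap.mem_ker, hφ, Submodule.mem_comap]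
    refine ⟨W.liftQ φ fun v hv => ?_, fun v => rfl, ?_⟩
    · rw [LinearMap.mem_ker, hm]
      have : W.mkQ v = 0 := by simpa using hv
      rw [this]
      exact Submodule.zero_mem _
    · intro z hz hzA
      obtain ⟨v, rfl⟩ := W.mkQ_surjective z
      have h1 : W.mkQ v ∈ c.submodule := (hm v).1 hz
      rw [mem_submodule_iff hzA.1] at h1
      obtain ⟨h2, h3⟩ := hzA
      rw [h1] at h3
      exact hc h3
  obtain ⟨φQ, hφQ, hφQA⟩ := key c φ hc hφ
  obtain ⟨φQ', hφQ', hφQA'⟩ := key c' φ' hc' hφ'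
  obtain ⟨αQ, βQ, v1, v2, h11, h12, h21, h22, hsp, hv1, hv2, hφab⟩ := coords hQ2 a b hab φQ
    (fun h => hφQA _ h (mem_iff_rep_cn.1 haArc)) (fun h => hφQA _ h (mem_iff_rep_cn.1 hbArc))
  have harc := arc_desc αQ βQ v1 v2 h11 h12 h21 h22 hsp Arc hArcConn a b hv1 hv2 haArc hbArc
    hArcFr (fun z hz => hφQA z (by rw [hφab, hz]))
  have hQ0 : ∀ z, z = 0 ↔ αQ z = 0 ∧ βQ z = 0 := by
    intro z
    constructor
    · rintro rfl
      simp
    · rintro ⟨h1, h2⟩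
      rw [hsp z, h1, h2]
      simp
  let α : Module.Dual ℝ (Vec n) := αQ ∘ₗ W.mkQ
  let β : Module.Dual ℝ (Vec n) := βQ ∘ₗ W.mkQ
  have hαQ : ∀ v, αQ (W.mkQ v) = α v := fun v => rfl
  have hβQ : ∀ v, βQ (W.mkQ v) = β v := fun v => rfl
  have hWz : ∀ v, v ∈ W ↔ W.mkQ v = 0 := fun v => by simp
  have hWαβ : ∀ v, v ∈ W ↔ α v = 0 ∧ β v = 0 := fun v => by rw [hWz, hQ0, hαQ, hβQ]
  have hline : ∀ (d : Projectivization ℝ (Vec n ⧸ W)) (w : Vec n ⧸ W) (_ : w ∈ cn {d}) z,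
      z ∈ d.submodule ↔ ∃ k : ℝ, z = k • w := by
    rintro d w ⟨hw0, hw⟩ z
    have hw' : Projectivization.mk ℝ w hw0 = d := hw
    rw [← hw', Projectivization.submodule_mk, Submodule.mem_span_singleton]
    exact ⟨fun ⟨k, h⟩ => ⟨k, h.symm⟩, fun ⟨k, h⟩ => ⟨k, h.symm⟩⟩
  have ha : ∀ v, W.mkQ v ∈ a.submodule ↔ β v = 0 := by
    intro v
    rw [hline a v1 hv1, ← hβQ]
    constructor
    · rintro ⟨k, h⟩
      rw [h]
      simp [h12]
    · intro h
      refine ⟨αQ (W.mkQ v), ?_⟩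
      have := hsp (W.mkQ v)
      rwa [h, zero_smul, add_zero] at this
  have hb : ∀ v, W.mkQ v ∈ b.submodule ↔ α v = 0 := by
    intro v
    rw [hline b v2 hv2, ← hαQ]
    constructor
    · rintro ⟨k, h⟩
      rw [h]
      simp [h21]
    · intro h
      refine ⟨βQ (W.mkQ v), ?_⟩
      have := hsp (W.mkQ v)
      rwa [h, zero_smul, zero_add] at this
  have hArc : ∀ v, v ∉ W → ((∃ y ∈ Arc, W.mkQ v ∈ y.submodule) ↔ 0 ≤ α v * β v) := by
    intro v hv
    have h0 : W.mkQ v ≠ 0 := fun h => hv ((hWz v).2 h)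
    rw [mem_cn_iff_exists h0, harc, hαQ, hβQ]
    exact and_iff_right h0
  obtain ⟨va, hva⟩ := W.mkQ_surjective v1
  obtain ⟨vb, hvb⟩ := W.mkQ_surjective v2
  have hαa : α va = 1 := by rw [← hαQ, hva, h11]
  have hβb : β vb = 1 := by rw [← hβQ, hvb, h22]
  have hrα := finrank_ker_eq hαa
  have hrβ := finrank_ker_eq hβb
  obtain ⟨hKa, hna⟩ := KK_convex hWαβ hAW (hA.2.2.1 (LinearMap.ker β)
    (fun v hv => ((hWαβ v).1 hv).2) (by omega))
  obtain ⟨hKb, hnb⟩ := KK_convex (α := β) (β := α) (fun v => (hWαβ v).trans and_comm) hAW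
    (hA.2.2.1 (LinearMap.ker α) (fun v hv => ((hWαβ v).1 hv).1) (by omega))
  have hS := surgery_cn hKa hKb hna hnb hWαβ hAW ha hb hArc (φ := φ) (κ := 1) (κ' := 1)
    (fun v => by rw [← hφQ, hφab, hαQ, hβQ]; ring) (by norm_num)
  have hκ : 0 < φQ' v1 * φQ' v2 := by
    by_contra hcon
    push Not at hcon
    have n1 : φQ' v1 ≠ 0 := fun h => hφQA' v1 h ((harc v1).2
      ⟨hv1.1, by rw [h12, mul_zero]⟩)
    refine hφQA' (φQ' v2 • v1 - φQ' v1 • v2) (by simp; ring) ((harc _).2 ⟨?_, ?_⟩)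
    · intro h
      have := congrArg βQ h
      simp [h12, h22] at this
      exact n1 this
    · simp only [map_sub, map_smul, smul_eq_mul, h11, h12, h21, h22]
      linarith
  have hS' := surgery_cn hKa hKb hna hnb hWαβ hAW ha hb hArc (φ := φ') (κ := φQ' v1)
    (κ' := φQ' v2)
    (fun v => by
      rw [← hφQ']
      conv_lhs => rw [hsp (W.mkQ v)]
      rw [map_add, map_smul, map_smul, hαQ, hβQ, smul_eq_mul, smul_eq_mul]
      ring) hκ
  refine ⟨set_ext_cn fun v => (hS v).trans (hS' v).symm, ?_⟩
  refine assemble_convexConcave hA hKa hKb hna hnb hWαβ hAW hS (fun x hx => hx.1) ?_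
  intro h
  have h1 : α va + β va = 0 := by
    have := LinearMap.congr_fun h va
    simpa using this
  have h2 : β va = 0 := by rw [← hβQ, hva, h12]
  rw [hαa, h2] at h1
  norm_num at h1

end CC
end
end

section
/- Let A ⊆ ℝP^n be an L-convex-concave set with dim L = 1 (L a projective line). Let {N_α}_{α∈I} be a family of 2-dimensional projective subspaces of ℝP^n containing L, and for each α let p⁺_α be a closed half-plane of the affine plane N_α ∖ L (the set where some nonconstant affine function on the chart is ≥ 0) such that A ∩ N_α ⊆ p⁺_α and the boundary line of p⁺_α intersects A ∩ N_α. For each α, let q_α ∈ L be the unique point at which the projective closure in N_α of the boundary line of p⁺_α meets L. If the set {q_α : α ∈ I} contains at most four points, then there exists a projective subspace of ℝP^n of dimension n − 2 intersecting p⁺_α for every α ∈ I. -/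
open Module Set Pointwise

noncomputable section

namespace CC

variable {M : Type*} [AddCommGroup M] [Module ℝ M]

/-- The cone (with the origin) over a subset of a projective space. -/
def coneOf {V : Type*} [AddCommGroup V] [Module ℝ V] (A : Set (Projectivization ℝ V)) : Set V :=
  {v | v = 0 ∨ ∃ h : v ≠ 0, Projectivization.mk ℝ v h ∈ A}

section helpers

variable {V : Type*} [AddCommGroup V] [Module ℝ V]

lemma coneOf_smul {A : Set (Projectivization ℝ V)} {v : V} (hv : v ∈ coneOf A) (c : ℝ) :
    c • v ∈ coneOf A := by
  rcases hv with rfl | ⟨h, hA⟩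
  · left; simp
  · by_cases hc : c = 0
    · left; simp [hc]
    · right
      have hcv : c • v ≠ 0 := smul_ne_zero hc h
      refine ⟨hcv, ?_⟩
      have : Projectivization.mk ℝ (c • v) hcv = Projectivization.mk ℝ v h := by
        rw [Projectivization.mk_eq_mk_iff']
        exact ⟨c, rfl⟩
      rwa [this]

lemma rep_mem_coneOf {A : Set (Projectivization ℝ V)} {x : Projectivization ℝ V} (hx : x ∈ A) :
    x.rep ∈ coneOf A := by
  right
  exact ⟨x.rep_nonzero, by rwa [Projectivization.mk_rep]⟩

lemma exists_rep_of_cone {A : Set (Projectivization ℝ V)} {v : V} (hv : v ∈ coneOf A)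
    (h0 : v ≠ 0) : ∃ x ∈ A, ∃ c : ℝ, c ≠ 0 ∧ x.rep = c • v := by
  rcases hv with rfl | ⟨h, hA⟩
  · exact absurd rfl h0
  · refine ⟨_, hA, ?_⟩
    obtain ⟨a, ha⟩ := Projectivization.exists_smul_eq_mk_rep ℝ v h
    exact ⟨(a : ℝ), a.ne_zero, ha.symm⟩

/-- The point of the quotient given by `v ∉ T` is outside the image iff no translate of `v` by `T`
lies in the cone. -/
lemma mem_compl_projImage_iff (T : Submodule ℝ V) (A : Set (Projectivization ℝ V)) (v : V)
    (hv : T.mkQ v ≠ 0) :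
    Projectivization.mk ℝ (T.mkQ v) hv ∈ (projImage T A)ᶜ ↔ ∀ t ∈ T, v + t ∉ coneOf A := by
  have hvT : v ∉ T := fun h => hv (by simpa using h)
  constructor
  · intro h t ht hc
    apply h
    have h0 : v + t ≠ 0 := by
      intro h0
      apply hvT
      have : v = -t := eq_neg_of_add_eq_zero_left h0
      rw [this]; exact T.neg_mem ht
    obtain ⟨x, hx, c, hc0, hxc⟩ := exists_rep_of_cone hc h0
    refine ⟨x, hx, ?_, ?_⟩
    · rw [hxc]
      intro hmem
      have := (T.smul_mem_iff hc0).1 hmem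
      exact hvT ((T.add_mem_iff_left ht).1 this)
    · rw [hxc, Projectivization.submodule_mk, Submodule.mem_span_singleton]
      refine ⟨c, ?_⟩
      have : T.mkQ t = 0 := by simpa using ht
      rw [map_smul, map_add, this, add_zero]
  · rintro h ⟨x, hx, hxT, hmem⟩
    rw [Projectivization.submodule_mk, Submodule.mem_span_singleton] at hmem
    obtain ⟨c, hc⟩ := hmem
    have hc0 : c ≠ 0 := by
      rintro rfl
      apply hxT
      have : T.mkQ x.rep = 0 := by rw [← hc]; simp
      simpa using this
    have hd : x.rep - c • v ∈ T := by
      have : T.mkQ (x.rep - c • v) = 0 := by rw [map_sub, map_smul, hc, sub_self]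
      exact (Submodule.Quotient.mk_eq_zero T).1 this
    apply h (c⁻¹ • (x.rep - c • v)) (T.smul_mem _ hd)
    have : v + c⁻¹ • (x.rep - c • v) = c⁻¹ • x.rep := by
      rw [smul_sub, smul_smul, inv_mul_cancel₀ hc0, one_smul]; abel
    rw [this]
    exact coneOf_smul (rep_mem_coneOf hx) _

/-- Cone form of the convexity of the complement of a projection. -/
lemma convex_cone_form (T : Submodule ℝ V) (A : Set (Projectivization ℝ V))
    (h : IsProjConvex (projImage T A)ᶜ) :
    ∃ Φ : Module.Dual ℝ V, (∀ t ∈ T, Φ t = 0) ∧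
      (∀ v ∉ T, (∀ t ∈ T, v + t ∉ coneOf A) → Φ v ≠ 0) ∧
      (∀ v₁ v₂ : V, v₁ ∉ T → v₂ ∉ T → (∀ t ∈ T, v₁ + t ∉ coneOf A) →
        (∀ t ∈ T, v₂ + t ∉ coneOf A) → 0 < Φ v₁ * Φ v₂ →
        (∀ t ∈ T, v₁ + v₂ + t ∉ coneOf A)) := by
  obtain ⟨φ, -, hne, hconv⟩ := h
  have key : ∀ v ∉ T, (∀ t ∈ T, v + t ∉ coneOf A) → φ (T.mkQ v) ≠ 0 ∧
      (φ (T.mkQ v))⁻¹ • T.mkQ v ∈ projChart φ '' (projImage T A)ᶜ := by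
    intro v hv hvt
    have hv0 : T.mkQ v ≠ 0 := by simpa using hv
    have hm := (mem_compl_projImage_iff T A v hv0).2 hvt
    obtain ⟨a, ha⟩ := Projectivization.exists_smul_eq_mk_rep ℝ (T.mkQ v) hv0
    have ha' : (Projectivization.mk ℝ (T.mkQ v) hv0).rep = (a : ℝ) • T.mkQ v := ha.symm
    have h1 := hne _ hm
    rw [ha', map_smul, smul_eq_mul] at h1
    have h2 := right_ne_zero_of_mul h1
    refine ⟨h2, _, hm, ?_⟩
    unfold projChart
    rw [ha', map_smul, smul_eq_mul, smul_smul]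
    congr 1
    have := a.ne_zero
    field_simp
  refine ⟨φ.comp T.mkQ, ?_, ?_, ?_⟩
  · intro t ht
    have : T.mkQ t = 0 := by simpa using ht
    rw [LinearMap.comp_apply, this, map_zero]
  · intro v hv hvt
    exact (key v hv hvt).1
  · intro v₁ v₂ h1 h2 h1t h2t hpos
    obtain ⟨k1, m1⟩ := key v₁ h1 h1t
    obtain ⟨k2, m2⟩ := key v₂ h2 h2t
    simp only [LinearMap.comp_apply] at hpos
    set p := φ (T.mkQ v₁) with hp
    set q := φ (T.mkQ v₂) with hq
    have hs : p + q ≠ 0 := by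
      intro h0
      have : q = -p := by linarith
      rw [this] at hpos
      nlinarith [sq_nonneg p]
    have hpp : 0 < p * (p + q) := by nlinarith [sq_nonneg p]
    have hqq : 0 < q * (p + q) := by nlinarith [sq_nonneg q]
    have e1 : 0 ≤ p / (p + q) := by
      have : p / (p + q) = p * (p + q) / (p + q) ^ 2 := by field_simp
      rw [this]; positivity
    have e2 : 0 ≤ q / (p + q) := by
      have : q / (p + q) = q * (p + q) / (p + q) ^ 2 := by field_simp
      rw [this]; positivity
    have hmem := hconv m1 m2 e1 e2 (by field_simp)
    have hcomb : (p / (p + q)) • p⁻¹ • T.mkQ v₁ + (q / (p + q)) • q⁻¹ • T.mkQ v₂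
        = (p + q)⁻¹ • T.mkQ (v₁ + v₂) := by
      rw [smul_smul, smul_smul, map_add, smul_add]
      congr 2 <;> field_simp
    rw [hcomb] at hmem
    obtain ⟨y, hy, hyc⟩ := hmem
    have hy0 := hne y hy
    have hv0 : T.mkQ (v₁ + v₂) ≠ 0 := by
      intro h0
      apply hs
      rw [hp, hq, ← map_add, ← map_add, h0, map_zero]
    have : Projectivization.mk ℝ (T.mkQ (v₁ + v₂)) hv0 = y := by
      rw [← Projectivization.mk_rep y, Projectivization.mk_eq_mk_iff']
      refine ⟨(p + q) * (φ y.rep)⁻¹, ?_⟩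
      unfold projChart at hyc
      rw [mul_smul, hyc, smul_smul, mul_inv_cancel₀ hs, one_smul]
    exact (mem_compl_projImage_iff T A _ hv0).1 (this ▸ hy)

/-- Subadditivity of the support function. -/
lemma subadd_aux (W : Submodule ℝ V) (A : Set (Projectivization ℝ V))
    (hAW : ∀ x ∈ A, x.rep ∉ W) (l : Module.Dual ℝ V) (b : V) (hb : b ∈ W) (hlb : l b = 1)
    (hconv : IsProjConvex (projImage (W ⊓ LinearMap.ker l) A)ᶜ)
    (v₁ v₂ : V) (t₁ t₂ : ℝ) (h₁ : ∀ w ∈ W, v₁ + w ∈ coneOf A → l (v₁ + w) ≤ t₁)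
    (h₂ : ∀ w ∈ W, v₂ + w ∈ coneOf A → l (v₂ + w) ≤ t₂) :
    ∀ w ∈ W, v₁ + v₂ + w ∈ coneOf A → l (v₁ + v₂ + w) ≤ t₁ + t₂ := by
  intro w hw hc
  by_contra hlt
  push Not at hlt
  obtain ⟨Φ, hΦT, hΦne, hΦc⟩ := convex_cone_form _ A hconv
  have hT : ∀ x, x ∈ W ⊓ LinearMap.ker l ↔ x ∈ W ∧ l x = 0 := by
    intro x; simp [Submodule.mem_inf]
  have hCW : ∀ v ∈ coneOf A, v ∈ W → v = 0 := by
    intro v hv hvW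
    by_contra h0
    obtain ⟨x, hx, c, hc0, hxc⟩ := exists_rep_of_cone hv h0
    exact hAW x hx (hxc ▸ W.smul_mem c hvW)
  have hκ : Φ b ≠ 0 := by
    apply hΦne
    · rw [hT]; rintro ⟨-, h⟩; rw [hlb] at h; exact one_ne_zero h
    · intro t ht hct
      rw [hT] at ht
      have := hCW _ hct (W.add_mem hb ht.1)
      have h2 := congrArg l this
      rw [map_add, hlb, ht.2] at h2; simp at h2
  have hΦW : ∀ x ∈ W, Φ x = l x * Φ b := by
    intro x hx
    have : x - l x • b ∈ W ⊓ LinearMap.ker l := by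
      rw [hT]
      refine ⟨W.sub_mem hx (W.smul_mem _ hb), ?_⟩
      rw [map_sub, map_smul, hlb]; simp
    have := hΦT _ this
    rw [map_sub, map_smul, smul_eq_mul] at this
    linarith
  -- general step for a single vector
  have step : ∀ (v : V) (t t' : ℝ), (∀ w ∈ W, v + w ∈ coneOf A → l (v + w) ≤ t) → t < t' →
      (v + (t' - l v) • b ∉ W ⊓ LinearMap.ker l) ∧
      (∀ τ ∈ W ⊓ LinearMap.ker l, v + (t' - l v) • b + τ ∉ coneOf A) ∧
      0 < Φ (v + (t' - l v) • b) / Φ b := by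
    intro v t t' h htt
    have hlv : l (v + (t' - l v) • b) = t' := by
      rw [map_add, map_smul, hlb]; simp
    have hW0 : v ∈ W → 0 ≤ t := by
      intro hv
      have := h (-v) (W.neg_mem hv) (by left; simp)
      simpa using this
    have hWv : v + (t' - l v) • b ∈ W → v ∈ W := fun hh =>
      (W.add_mem_iff_left (W.smul_mem _ hb)).1 hh
    refine ⟨?_, ?_, ?_⟩
    · rw [hT]
      rintro ⟨ha, hb'⟩
      have := hW0 (hWv ha)
      linarith
    · intro τ hτ hcτ
      rw [hT] at hτ
      have := h ((t' - l v) • b + τ) (W.add_mem (W.smul_mem _ hb) hτ.1) (by rwa [← add_assoc])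
      rw [← add_assoc, map_add, hlv, hτ.2] at this
      linarith
    · by_contra hneg
      push Not at hneg
      set r := - (Φ (v + (t' - l v) • b) / Φ b) with hr
      have hr0 : 0 ≤ r := by linarith
      have hΦ0 : Φ (v + (t' - l v) • b + r • b) = 0 := by
        rw [map_add _ _ (r • b), map_smul Φ r b, hr, smul_eq_mul]
        field_simp; ring
      refine hΦne (v + (t' - l v) • b + r • b) ?_ ?_ hΦ0
      · rw [hT]
        rintro ⟨ha, hb'⟩
        have := hW0 (hWv ((W.add_mem_iff_left (W.smul_mem _ hb)).1 ha))
        rw [map_add, hlv, map_smul, hlb] at hb'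
        simp at hb'
        linarith
      · intro τ hτ hcτ
        rw [hT] at hτ
        have := h ((t' - l v) • b + r • b + τ)
          (W.add_mem (W.add_mem (W.smul_mem _ hb) (W.smul_mem _ hb)) hτ.1)
          (by rwa [← add_assoc, ← add_assoc])
        rw [← add_assoc, ← add_assoc, map_add, map_add, hlv, hτ.2, map_smul, hlb] at this
        simp at this
        linarith
  set d := (l (v₁ + v₂ + w) - t₁ - t₂) / 2 with hd
  have hd0 : 0 < d := by rw [hd]; linarith
  obtain ⟨a1, a2, a3⟩ := step v₁ t₁ (t₁ + d) h₁ (by linarith)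
  obtain ⟨b1, b2, b3⟩ := step v₂ t₂ (t₂ + d) h₂ (by linarith)
  have hprod : 0 < Φ (v₁ + (t₁ + d - l v₁) • b) * Φ (v₂ + (t₂ + d - l v₂) • b) := by
    have := mul_pos (mul_pos a3 b3) (mul_self_pos.2 hκ)
    have e : Φ (v₁ + (t₁ + d - l v₁) • b) / Φ b * (Φ (v₂ + (t₂ + d - l v₂) • b) / Φ b)
      * (Φ b * Φ b) = Φ (v₁ + (t₁ + d - l v₁) • b) * Φ (v₂ + (t₂ + d - l v₂) • b) := by
      field_simp
    rwa [e] at this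
  have hfin := hΦc _ _ a1 b1 a2 b2 hprod (w - (t₁ + d - l v₁) • b - (t₂ + d - l v₂) • b) (by
    rw [hT]
    refine ⟨W.sub_mem (W.sub_mem hw (W.smul_mem _ hb)) (W.smul_mem _ hb), ?_⟩
    simp only [map_sub, map_smul, hlb, smul_eq_mul, mul_one]
    have : l (v₁ + v₂ + w) = l v₁ + l v₂ + l w := by simp
    rw [this] at hd
    linarith)
  apply hfin
  convert hc using 1
  abel

/-- Boundedness of the sections, from openness. -/
lemma bdd_aux [TopologicalSpace V] [IsTopologicalAddGroup V] [ContinuousSMul ℝ V]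
    (W : Submodule ℝ V) (A : Set (Projectivization ℝ V))
    (hAW : ∀ x ∈ A, x.rep ∉ W) (l : Module.Dual ℝ V) (b : V) (hb : b ∈ W) (hlb : l b = 1)
    (hopen : IsOpen (projImage (W ⊓ LinearMap.ker l) A)ᶜ) (v : V) :
    ∃ K : ℝ, ∀ w ∈ W, v + w ∈ coneOf A → l (v + w) ≤ K := by
  have hT : ∀ x, x ∈ W ⊓ LinearMap.ker l ↔ x ∈ W ∧ l x = 0 := by
    intro x; simp [Submodule.mem_inf]
  have hCW : ∀ v ∈ coneOf A, v ∈ W → v = 0 := by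
    intro v hv hvW
    by_contra h0
    obtain ⟨x, hx, c, hc0, hxc⟩ := exists_rep_of_cone hv h0
    exact hAW x hx (hxc ▸ W.smul_mem c hvW)
  by_cases hvW : v ∈ W
  · refine ⟨0, fun w hw hc => ?_⟩
    rw [hCW _ hc (W.add_mem hvW hw)]; simp
  set T := W ⊓ LinearMap.ker l with hTdef
  have hne : ∀ ε : ℝ, T.mkQ (b + ε • v) ≠ 0 := by
    intro ε h0
    have h1 : b + ε • v ∈ T := (Submodule.Quotient.mk_eq_zero T).1 h0
    rw [hT] at h1
    by_cases hε : ε = 0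
    · have := h1.2
      rw [hε, map_add, hlb] at this
      simp at this
    · exact hvW ((W.smul_mem_iff hε).1 ((W.add_mem_iff_right hb).1 h1.1))
  let f : ℝ → Projectivization ℝ (V ⧸ T) := fun ε => Projectivization.mk ℝ (T.mkQ (b + ε • v)) (hne ε)
  have hf : Continuous f := by
    have h1 : Continuous (fun ε : ℝ => (⟨T.mkQ (b + ε • v), hne ε⟩ : {x : V ⧸ T // x ≠ 0})) := by
      refine Continuous.subtype_mk ?_ _
      have h2 : Continuous (T.mkQ : V → V ⧸ T) := continuous_quot_mk
      exact h2.comp (by fun_prop)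
    have h3 : Continuous (fun x : {x : V ⧸ T // x ≠ 0} => Projectivization.mk ℝ x.1 x.2) :=
      continuous_quot_mk
    exact h3.comp h1
  have hpre := hopen.preimage hf
  have h0 : (0 : ℝ) ∈ f ⁻¹' (projImage T A)ᶜ := by
    show f 0 ∈ (projImage T A)ᶜ
    rw [mem_compl_projImage_iff]
    intro t ht hct
    rw [hT] at ht
    rw [zero_smul, add_zero] at hct
    have := hCW _ hct (W.add_mem hb ht.1)
    have h2 := congrArg l this
    rw [map_add, hlb, ht.2] at h2; simp at h2
  obtain ⟨δ, hδ, hball⟩ := Metric.isOpen_iff.1 hpre 0 h0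
  refine ⟨l v + δ⁻¹, fun w hw hc => ?_⟩
  by_contra hlt
  push Not at hlt
  rw [map_add] at hlt
  have hlw : δ⁻¹ < l w := by linarith
  have hlw0 : 0 < l w := lt_trans (inv_pos.2 hδ) hlw
  have hin : (l w)⁻¹ ∈ Metric.ball (0 : ℝ) δ := by
    rw [Metric.mem_ball, dist_zero_right, Real.norm_eq_abs, abs_of_pos (inv_pos.2 hlw0)]
    exact inv_lt_of_inv_lt₀ hδ hlw
  have hm : f (l w)⁻¹ ∈ (projImage T A)ᶜ := hball hin
  rw [mem_compl_projImage_iff] at hm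
  apply hm ((l w)⁻¹ • w - b)
  · rw [hT]
    refine ⟨W.sub_mem (W.smul_mem _ hw) hb, ?_⟩
    rw [map_sub, map_smul, hlb, smul_eq_mul, inv_mul_cancel₀ hlw0.ne', sub_self]
  · have : b + (l w)⁻¹ • v + ((l w)⁻¹ • w - b) = (l w)⁻¹ • (v + w) := by
      rw [smul_add]; abel
    rw [this]
    exact coneOf_smul hc _

/-- Nonemptiness of sections. -/
lemma nonempty_aux [FiniteDimensional ℝ V] (W : Submodule ℝ V) (A : Set (Projectivization ℝ V))
    (hAW : ∀ x ∈ A, x.rep ∉ W)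
    (hsec : ∀ N : Submodule ℝ V, W ≤ N → finrank ℝ N = finrank ℝ W + 1 →
      (A ∩ projSet N).Nonempty) (v : V) : ∃ w ∈ W, v + w ∈ coneOf A := by
  by_cases hv : v ∈ W
  · exact ⟨-v, W.neg_mem hv, by left; simp⟩
  · have hdim : finrank ℝ (W ⊔ Submodule.span ℝ {v} : Submodule ℝ V) = finrank ℝ W + 1 := by
      have h1 := Submodule.finrank_sup_add_finrank_inf_eq W (Submodule.span ℝ {v})
      have hv0 : v ≠ 0 := by rintro rfl; exact hv W.zero_mem
      have h2 : W ⊓ Submodule.span ℝ {v} = ⊥ := by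
        rw [← disjoint_iff, Submodule.disjoint_span_singleton' hv0]
        exact hv
      rw [h2, finrank_bot, finrank_span_singleton hv0] at h1
      simpa using h1
    obtain ⟨x, hxA, hxN⟩ := hsec _ le_sup_left hdim
    have hxN' : x.rep ∈ W ⊔ Submodule.span ℝ {v} := hxN
    obtain ⟨w, hw, z, hz, hwz⟩ := Submodule.mem_sup.1 hxN'
    obtain ⟨c, rfl⟩ := Submodule.mem_span_singleton.1 hz
    have hc0 : c ≠ 0 := by
      rintro rfl
      apply hAW x hxA
      rw [← hwz]; simpa using hw
    refine ⟨c⁻¹ • w, W.smul_mem _ hw, ?_⟩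
    have : v + c⁻¹ • w = c⁻¹ • x.rep := by
      rw [← hwz, smul_add, smul_smul, inv_mul_cancel₀ hc0, one_smul, add_comm]
    rw [this]
    exact coneOf_smul (rep_mem_coneOf hxA) _

/-- The Hahn–Banach step. -/
lemma hahn_banach_four (s₁ s₂ s₃ s₄ : ℝ) (h12 : s₁ ≤ s₂) (h23 : s₂ ≤ s₃) (h34 : s₃ ≤ s₄)
    (h14 : s₁ < s₄) (H : ℝ → V → ℝ)
    (hpos : ∀ s v (c : ℝ), 0 < c → H s (c • v) = c * H s v)
    (hsub : ∀ s v w, H s (v + w) ≤ H s v + H s w)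
    (hL : ∀ (a b c s t r : ℝ) (v : V), 0 ≤ a → 0 ≤ b → 0 ≤ c → a = c - b → a * s = c * t - b * r →
      a * H s v ≤ c * H t v + b * H r (-v)) :
    ∃ X Y : Module.Dual ℝ V, ∀ s ∈ ({s₁, s₂, s₃, s₄} : Set ℝ), ∀ v, X v + s * Y v ≤ H s v := by
  have H0 : ∀ s, H s 0 = 0 := by
    intro s
    have := hpos s 0 2 (by norm_num)
    rw [smul_zero] at this; linarith
  have hpos' : ∀ s v (c : ℝ), 0 ≤ c → H s (c • v) = c * H s v := by
    intro s v c hc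
    rcases hc.eq_or_lt with rfl | hc
    · rw [zero_smul, H0, zero_mul]
    · exact hpos s v c hc
  have key : ∀ u₁ u₂ u₃ u₄ : V, u₁ + u₂ + u₃ + u₄ = 0 →
      s₁ • u₁ + s₂ • u₂ + s₃ • u₃ + s₄ • u₄ = 0 →
      0 ≤ H s₁ u₁ + H s₂ u₂ + H s₃ u₃ + H s₄ u₄ := by
    intro u₁ u₂ u₃ u₄ e1 e2
    have ea : (s₃ - s₁) • (-u₃) = (s₂ - s₁) • u₂ + (s₄ - s₁) • u₄ := by
      have e : (s₃ - s₁) • (-u₃) - ((s₂ - s₁) • u₂ + (s₄ - s₁) • u₄) =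
          s₁ • (u₁ + u₂ + u₃ + u₄) - (s₁ • u₁ + s₂ • u₂ + s₃ • u₃ + s₄ • u₄) := by module
      rw [e1, e2, smul_zero, sub_zero] at e
      exact sub_eq_zero.1 e
    have ed : (s₄ - s₂) • (-u₂) = (s₄ - s₁) • u₁ + (s₄ - s₃) • u₃ := by
      have e : (s₄ - s₂) • (-u₂) - ((s₄ - s₁) • u₁ + (s₄ - s₃) • u₃) =
          (s₁ • u₁ + s₂ • u₂ + s₃ • u₃ + s₄ • u₄) - s₄ • (u₁ + u₂ + u₃ + u₄) := by module
      rw [e1, e2, smul_zero, sub_zero] at e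
      exact sub_eq_zero.1 e
    have A1 := hsub s₄ ((s₂ - s₁) • u₂) ((s₄ - s₁) • u₄)
    rw [← ea, hpos' _ _ _ (by linarith), hpos' _ _ _ (by linarith), hpos' _ _ _ (by linarith)] at A1
    have D1 := hsub s₁ ((s₄ - s₁) • u₁) ((s₄ - s₃) • u₃)
    rw [← ed, hpos' _ _ _ (by linarith), hpos' _ _ _ (by linarith), hpos' _ _ _ (by linarith)] at D1
    have B1 := hL (s₄ - s₃) (s₃ - s₁) (s₄ - s₁) s₁ s₃ s₄ u₃ (by linarith) (by linarith)
      (by linarith) (by ring) (by ring)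
    have C1 := hL (s₂ - s₁) (s₄ - s₂) (s₄ - s₁) s₄ s₂ s₁ u₂ (by linarith) (by linarith)
      (by linarith) (by ring) (by ring)
    have : 0 ≤ (s₄ - s₁) * (H s₁ u₁ + H s₂ u₂ + H s₃ u₃ + H s₄ u₄) := by nlinarith
    exact nonneg_of_mul_nonneg_right this (by linarith)
  -- the subspace
  let P : (V × V × V × V) →ₗ[ℝ] V × V :=
    { toFun := fun u => (u.1 + u.2.1 + u.2.2.1 + u.2.2.2,
        s₁ • u.1 + s₂ • u.2.1 + s₃ • u.2.2.1 + s₄ • u.2.2.2)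
      map_add' := by
        intro x y
        ext <;> simp <;> module
      map_smul' := by
        intro c x
        ext <;> simp <;> module }
  obtain ⟨G, hG0, hG⟩ := exists_extension_of_le_sublinear
    (⟨LinearMap.ker P, 0⟩ : (V × V × V × V) →ₗ.[ℝ] ℝ)
    (fun u => H s₁ u.1 + H s₂ u.2.1 + H s₃ u.2.2.1 + H s₄ u.2.2.2)
    (by
      intro c hc x
      simp only [Prod.smul_fst, Prod.smul_snd, hpos _ _ c hc]; ring)
    (by
      intro x y
      simp only [Prod.fst_add, Prod.snd_add]
      linarith [hsub s₁ x.1 y.1, hsub s₂ x.2.1 y.2.1, hsub s₃ x.2.2.1 y.2.2.1,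
        hsub s₄ x.2.2.2 y.2.2.2])
    (by
      rintro ⟨x, hx⟩
      have hx' : P x = 0 := hx
      have := Prod.ext_iff.1 hx'
      exact key _ _ _ _ this.1 this.2)
  have hGk : ∀ u₁ u₂ u₃ u₄ : V, u₁ + u₂ + u₃ + u₄ = 0 →
      s₁ • u₁ + s₂ • u₂ + s₃ • u₃ + s₄ • u₄ = 0 → G (u₁, u₂, u₃, u₄) = 0 := by
    intro u₁ u₂ u₃ u₄ e1 e2
    exact hG0 ⟨(u₁, u₂, u₃, u₄), by
      show P _ = 0
      exact Prod.ext e1 e2⟩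
  let i₁ : V →ₗ[ℝ] V × V × V × V := LinearMap.inl ℝ V (V × V × V)
  let i₂ : V →ₗ[ℝ] V × V × V × V := (LinearMap.inr ℝ V (V × V × V)).comp (LinearMap.inl ℝ V (V × V))
  let i₃ : V →ₗ[ℝ] V × V × V × V := (LinearMap.inr ℝ V (V × V × V)).comp
    ((LinearMap.inr ℝ V (V × V)).comp (LinearMap.inl ℝ V V))
  let i₄ : V →ₗ[ℝ] V × V × V × V := (LinearMap.inr ℝ V (V × V × V)).comp
    ((LinearMap.inr ℝ V (V × V)).comp (LinearMap.inr ℝ V V))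
  have b1 : ∀ v, G (i₁ v) ≤ H s₁ v := fun v => by simpa [i₁, H0] using hG (i₁ v)
  have b2 : ∀ v, G (i₂ v) ≤ H s₂ v := fun v => by simpa [i₂, H0] using hG (i₂ v)
  have b3 : ∀ v, G (i₃ v) ≤ H s₃ v := fun v => by simpa [i₃, H0] using hG (i₃ v)
  have b4 : ∀ v, G (i₄ v) ≤ H s₄ v := fun v => by simpa [i₄, H0] using hG (i₄ v)
  have r2 : ∀ v, (s₄ - s₂) * G (i₁ v) + (s₂ - s₁) * G (i₄ v) = (s₄ - s₁) * G (i₂ v) := by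
    intro v
    have := hGk ((s₄ - s₂) • v) (-((s₄ - s₁) • v)) 0 ((s₂ - s₁) • v) (by module) (by module)
    have e : (((s₄ - s₂) • v), (-((s₄ - s₁) • v)), (0 : V), ((s₂ - s₁) • v))
      = (s₄ - s₂) • i₁ v + (s₂ - s₁) • i₄ v - (s₄ - s₁) • i₂ v := by
      simp [i₁, i₂, i₄]
    rw [e, map_sub, map_add, map_smul, map_smul, map_smul] at this
    simp only [smul_eq_mul] at this
    linarith
  have r3 : ∀ v, (s₄ - s₃) * G (i₁ v) + (s₃ - s₁) * G (i₄ v) = (s₄ - s₁) * G (i₃ v) := by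
    intro v
    have := hGk ((s₄ - s₃) • v) 0 (-((s₄ - s₁) • v)) ((s₃ - s₁) • v) (by module) (by module)
    have e : (((s₄ - s₃) • v), (0 : V), (-((s₄ - s₁) • v)), ((s₃ - s₁) • v))
      = (s₄ - s₃) • i₁ v + (s₃ - s₁) • i₄ v - (s₄ - s₁) • i₃ v := by
      simp [i₁, i₃, i₄]
    rw [e, map_sub, map_add, map_smul, map_smul, map_smul] at this
    simp only [smul_eq_mul] at this
    linarith
  have hne : s₄ - s₁ ≠ 0 := by linarith
  refine ⟨G.comp i₁ - (s₁ * (s₄ - s₁)⁻¹) • (G.comp i₄ - G.comp i₁),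
    (s₄ - s₁)⁻¹ • (G.comp i₄ - G.comp i₁), ?_⟩
  have heq : ∀ s v, (G.comp i₁ - (s₁ * (s₄ - s₁)⁻¹) • (G.comp i₄ - G.comp i₁)) v +
      s * ((s₄ - s₁)⁻¹ • (G.comp i₄ - G.comp i₁)) v =
      ((s₄ - s) * G (i₁ v) + (s - s₁) * G (i₄ v)) / (s₄ - s₁) := by
    intro s v
    simp only [LinearMap.sub_apply, LinearMap.smul_apply, LinearMap.comp_apply, smul_eq_mul]
    field_simp
    ring
  intro s hs v
  rw [heq]
  simp only [mem_insert_iff, mem_singleton_iff] at hs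
  rcases hs with rfl | rfl | rfl | rfl
  · refine le_trans (le_of_eq ?_) (b1 v)
    field_simp; ring
  · rw [r2, mul_div_cancel_left₀ _ hne]; exact b2 v
  · rw [r3, mul_div_cancel_left₀ _ hne]; exact b3 v
  · refine le_trans (le_of_eq ?_) (b4 v)
    field_simp; ring

lemma four_reals (S : Finset ℝ) (hS : S.card ≤ 4) :
    ∃ s₁ s₂ s₃ s₄ : ℝ, s₁ ≤ s₂ ∧ s₂ ≤ s₃ ∧ s₃ ≤ s₄ ∧ s₁ < s₄ ∧
      ∀ s ∈ S, s ∈ ({s₁, s₂, s₃, s₄} : Set ℝ) := by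
  obtain ⟨S', hSS, hc⟩ := Infinite.exists_superset_card_eq S 4 hS
  let f := S'.orderEmbOfFin hc
  refine ⟨f 0, f 1, f 2, f 3, f.monotone (by decide), f.monotone (by decide),
    f.monotone (by decide), f.strictMono (by decide), ?_⟩
  intro s hs
  have : s ∈ Set.range f := by
    rw [Finset.range_orderEmbOfFin]; exact hSS hs
  obtain ⟨i, rfl⟩ := this
  fin_cases i <;> simp

end helpers

section helpers2

variable {V : Type*} [AddCommGroup V] [Module ℝ V]

/-- Coordinates on `W` such that the second one vanishes at no point of `Q ∩ ℙ(W)`. -/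
lemma coords_s17 [FiniteDimensional ℝ V] (W : Submodule ℝ V) (hW : finrank ℝ W = 2)
    (Q : Finset (Projectivization ℝ V)) :
    ∃ (X Y : Module.Dual ℝ V) (b₁ b₂ : V), b₁ ∈ W ∧ b₂ ∈ W ∧ X b₁ = 1 ∧ Y b₁ = 0 ∧ X b₂ = 0 ∧
      Y b₂ = 1 ∧ (∀ w ∈ W, w = X w • b₁ + Y w • b₂) ∧
      ∀ q ∈ Q, q.rep ∈ W → Y q.rep ≠ 0 := by
  let B := Module.finBasisOfFinrankEq ℝ W hW
  obtain ⟨x, hx⟩ := LinearMap.exists_extend (B.coord 0)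
  obtain ⟨y, hy⟩ := LinearMap.exists_extend (B.coord 1)
  have hx' : ∀ w : W, x w = B.coord 0 w := fun w => by rw [← hx]; rfl
  have hy' : ∀ w : W, y w = B.coord 1 w := fun w => by rw [← hy]; rfl
  have hrep : ∀ w ∈ W, w = x w • (B 0 : V) + y w • (B 1 : V) := by
    intro w hw
    have h1 := B.sum_repr ⟨w, hw⟩
    rw [Fin.sum_univ_two] at h1
    have h2 := congrArg Subtype.val h1
    have h3 := hx' ⟨w, hw⟩
    have h4 := hy' ⟨w, hw⟩
    simp only [Module.Basis.coord_apply] at h3 h4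
    rw [h3, h4]
    simpa using h2.symm
  have x0 : x (B 0 : V) = 1 := by rw [hx']; simp
  have x1 : x (B 1 : V) = 0 := by rw [hx']; simp
  have y0 : y (B 0 : V) = 0 := by rw [hy']; simp
  have y1 : y (B 1 : V) = 1 := by rw [hy']; simp
  classical
  obtain ⟨r, hr⟩ := Infinite.exists_notMem_finset (Q.image fun q => y q.rep / x q.rep)
  refine ⟨x, y - r • x, B 0 + r • (B 1 : V), B 1, W.add_mem (B 0).2 (W.smul_mem _ (B 1).2),
    (B 1).2, by simp [x0, x1], by simp [x0, x1, y0, y1], x1, by simp [x1, y1], ?_, ?_⟩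
  · intro w hw
    conv_lhs => rw [hrep w hw]
    simp only [LinearMap.sub_apply, LinearMap.smul_apply, smul_eq_mul]
    module
  · intro q hq hqW h0
    simp only [LinearMap.sub_apply, LinearMap.smul_apply, smul_eq_mul] at h0
    by_cases hxq : x q.rep = 0
    · rw [hxq] at h0
      apply q.rep_nonzero
      rw [hrep _ hqW, hxq, show y q.rep = 0 by linarith]; simp
    · apply hr
      rw [Finset.mem_image]
      refine ⟨q, hq, ?_⟩
      rw [div_eq_iff hxq]; linarith

lemma finrank_inf_ker [FiniteDimensional ℝ V] (W : Submodule ℝ V) (l : Module.Dual ℝ V) (b : V)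
    (hb : b ∈ W) (hlb : l b = 1) :
    finrank ℝ (W ⊓ LinearMap.ker l : Submodule ℝ V) + 1 = finrank ℝ W := by
  have h1 := (l.domRestrict W).finrank_range_add_finrank_ker
  have h2 : LinearMap.range (l.domRestrict W) = ⊤ := by
    rw [LinearMap.range_eq_top]
    intro r
    exact ⟨r • ⟨b, hb⟩, by simp [hlb]⟩
  rw [h2, finrank_top, finrank_self] at h1
  have h3 : Submodule.map W.subtype (LinearMap.ker (l.domRestrict W)) = W ⊓ LinearMap.ker l := by
    ext z
    simp only [Submodule.mem_map, LinearMap.mem_ker, Submodule.mem_inf]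
    constructor
    · rintro ⟨w, hw, rfl⟩
      exact ⟨w.2, hw⟩
    · rintro ⟨h, h'⟩
      exact ⟨⟨z, h⟩, h', rfl⟩
  have h4 := (Submodule.equivMapOfInjective W.subtype W.subtype_injective
    (LinearMap.ker (l.domRestrict W))).finrank_eq
  rw [← h3, ← h4]
  omega

/-- The selection of a linear section supporting the four directions. -/
lemma selection [FiniteDimensional ℝ V] [TopologicalSpace V] [IsTopologicalAddGroup V]
    [ContinuousSMul ℝ V] (W : Submodule ℝ V)
    (A : Set (Projectivization ℝ V)) (hA : IsLConvexConcave W A)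
    (X Y : Module.Dual ℝ V) (b : V) (hb : b ∈ W) (hX : X b = 1) (hY : Y b = 0)
    (S : Finset ℝ) (hS : S.card ≤ 4) :
    ∃ X' Y' : Module.Dual ℝ V, (∀ w ∈ W, X' w = 0) ∧ (∀ w ∈ W, Y' w = 0) ∧
      ∀ s ∈ S, ∀ v, ∀ K : ℝ, (∀ w ∈ W, v + w ∈ coneOf A → X (v + w) + s * Y (v + w) ≤ K) →
        X' v + s * Y' v ≤ K := by
  obtain ⟨-, hAW, hsec, hT⟩ := hA
  obtain ⟨s₁, s₂, s₃, s₄, h12, h23, h34, h14, hSs⟩ := four_reals S hS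
  let l : ℝ → Module.Dual ℝ V := fun s => X + s • Y
  have hl : ∀ s v, l s v = X v + s * Y v := fun s v => by simp [l]
  have hlb : ∀ s, l s b = 1 := fun s => by rw [hl, hX, hY]; ring
  have hTs := fun s => hT (W ⊓ LinearMap.ker (l s)) inf_le_left (finrank_inf_ker W (l s) b hb (hlb s))
  let Sec : ℝ → V → Set ℝ := fun s v => {r | ∃ w ∈ W, v + w ∈ coneOf A ∧ r = l s (v + w)}
  let H : ℝ → V → ℝ := fun s v => sSup (Sec s v)
  have hne : ∀ s v, (Sec s v).Nonempty := by
    intro s v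
    obtain ⟨w, hw, hc⟩ := nonempty_aux W A hAW (fun N h1 h2 => (hsec N h1 h2).1) v
    exact ⟨_, w, hw, hc, rfl⟩
  have hbdd : ∀ s v, BddAbove (Sec s v) := by
    intro s v
    obtain ⟨K, hK⟩ := bdd_aux W A hAW (l s) b hb (hlb s) (hTs s).1 v
    refine ⟨K, ?_⟩
    rintro r ⟨w, hw, hc, rfl⟩
    exact hK w hw hc
  have hle : ∀ s v w, w ∈ W → v + w ∈ coneOf A → l s (v + w) ≤ H s v := fun s v w hw hc =>
    le_csSup (hbdd s v) ⟨w, hw, hc, rfl⟩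
  have hleK : ∀ s v K, (∀ w ∈ W, v + w ∈ coneOf A → l s (v + w) ≤ K) → H s v ≤ K := by
    intro s v K h
    refine csSup_le (hne s v) ?_
    rintro r ⟨w, hw, hc, rfl⟩
    exact h w hw hc
  have hposle : ∀ s v (c : ℝ), 0 < c → H s (c • v) ≤ c * H s v := by
    intro s v c hc
    apply hleK
    intro w hw hcw
    have e : c • v + w = c • (v + c⁻¹ • w) := by
      rw [smul_add, smul_smul, mul_inv_cancel₀ hc.ne', one_smul]
    have h1 : v + c⁻¹ • w ∈ coneOf A := by
      have := coneOf_smul hcw c⁻¹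
      rwa [e, smul_smul, inv_mul_cancel₀ hc.ne', one_smul] at this
    rw [e, map_smul, smul_eq_mul]
    exact mul_le_mul_of_nonneg_left (hle s v _ (W.smul_mem _ hw) h1) hc.le
  have hpos : ∀ s v (c : ℝ), 0 < c → H s (c • v) = c * H s v := by
    intro s v c hc
    apply le_antisymm (hposle s v c hc)
    have := hposle s (c • v) c⁻¹ (inv_pos.2 hc)
    rw [smul_smul, inv_mul_cancel₀ hc.ne', one_smul] at this
    calc c * H s v ≤ c * (c⁻¹ * H s (c • v)) := mul_le_mul_of_nonneg_left this hc.le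
      _ = H s (c • v) := by field_simp
  have hsub : ∀ s v w, H s (v + w) ≤ H s v + H s w := by
    intro s v w
    apply hleK
    exact subadd_aux W A hAW (l s) b hb (hlb s) (hTs s).2 v w _ _ (hle s v) (hle s w)
  have hL : ∀ (a b c s t r : ℝ) (v : V), 0 ≤ a → 0 ≤ b → 0 ≤ c → a = c - b →
      a * s = c * t - b * r → a * H s v ≤ c * H t v + b * H r (-v) := by
    intro a b c s t r v ha hb hc h1 h2
    rcases ha.eq_or_lt with rfl | ha
    · have hcb : c = b := by linarith
      subst hcb
      rcases hc.eq_or_lt with rfl | hc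
      · simp
      · have htr : t = r := by
          have : c * (t - r) = 0 := by linarith
          rcases mul_eq_zero.1 this with h | h
          · exact absurd h hc.ne'
          · linarith
        subst htr
        have h0 : 0 ≤ H t v + H t (-v) := by
          have := hsub t v (-v)
          rw [add_neg_cancel] at this
          refine le_trans ?_ this
          have := hle t 0 0 W.zero_mem (by left; simp)
          simpa using this
        nlinarith
    · have : H s v ≤ (c * H t v + b * H r (-v)) / a := by
        apply hleK
        intro w hw hcw
        rw [le_div_iff₀ ha]
        have m1 := mul_le_mul_of_nonneg_left (hle t v w hw hcw) hc
        have m2 := mul_le_mul_of_nonneg_left (hle r (-v) (-w) (W.neg_mem hw) (by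
          have := coneOf_smul hcw (-1)
          convert this using 1
          module)) hb
        rw [← neg_add, map_neg] at m2
        rw [hl] at m1 m2 ⊢
        have e : (X (v + w) + s * Y (v + w)) * a = c * (X (v + w) + t * Y (v + w)) +
            b * -(X (v + w) + r * Y (v + w)) := by
          linear_combination X (v + w) * h1 + Y (v + w) * h2
        linarith
      rw [le_div_iff₀ ha] at this
      linarith
  obtain ⟨X', Y', hXY⟩ := hahn_banach_four s₁ s₂ s₃ s₄ h12 h23 h34 h14 H hpos hsub hL
  have hW0 : ∀ s, ∀ w ∈ W, H s w ≤ 0 := by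
    intro s w hw
    apply hleK
    intro w' hw' hc
    have : w + w' = 0 := by
      by_contra h0
      obtain ⟨x, hx, c, -, hxc⟩ := exists_rep_of_cone hc h0
      exact hAW x hx (hxc ▸ W.smul_mem c (W.add_mem hw hw'))
    rw [this, map_zero]
  have hz : ∀ w ∈ W, X' w = 0 ∧ Y' w = 0 := by
    intro w hw
    have p1 := (hXY s₁ (by simp) w).trans (hW0 s₁ w hw)
    have p2 := (hXY s₁ (by simp) (-w)).trans (hW0 s₁ _ (W.neg_mem hw))
    have p3 := (hXY s₄ (by simp) w).trans (hW0 s₄ w hw)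
    have p4 := (hXY s₄ (by simp) (-w)).trans (hW0 s₄ _ (W.neg_mem hw))
    simp only [map_neg] at p2 p4
    have q1 : X' w + s₁ * Y' w = 0 := by linarith
    have q2 : X' w + s₄ * Y' w = 0 := by linarith
    have q3 : (s₄ - s₁) * Y' w = 0 := by linarith
    have hY0 : Y' w = 0 := by
      rcases mul_eq_zero.1 q3 with h | h
      · linarith
      · exact h
    refine ⟨?_, hY0⟩
    rw [hY0] at q1; linarith
  refine ⟨X', Y', fun w hw => (hz w hw).1, fun w hw => (hz w hw).2, ?_⟩
  intro s hs v K hK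
  refine (hXY s (hSs s hs) v).trans (hleK s v K ?_)
  intro w hw hc
  rw [hl]; exact hK w hw hc

end helpers2

/-- Let `A ⊆ ℝPⁿ` be `L`-convex-concave with `L = ℙ(W)` a projective
line.  For each member `N i = ℙ(Nfam i)` of a family of 2-dimensional projective
subspaces containing `L`, let `p⁺ᵢ` be a closed half-plane of the affine plane
`Nᵢ ∖ L` supporting the section `A ∩ Nᵢ`.  Here the chart on `Nᵢ ∖ L` is given by a
functional `φ i` with `ker (φ i) ∩ Nfam i = W`, and `p⁺ᵢ = {x ∈ Nᵢ ∖ L | g i x / φ i x ≥ 0}`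
for a functional `g i` which is not proportional to `φ i` on `Nfam i` (so the cutting
affine function is nonconstant on the chart); `A ∩ Nᵢ ⊆ p⁺ᵢ` and the boundary line of
`p⁺ᵢ` meets `A ∩ Nᵢ`.  The boundary line of `p⁺ᵢ` meets `L` at the unique point `qᵢ`
with `qᵢ.rep ∈ W ∩ ker (g i)`.  If `{qᵢ}` contains at most four points, then some
projective subspace of dimension `n − 2` meets every `p⁺ᵢ`. -/
theorem statement17 (n : ℕ) (W : Submodule ℝ (Vec n)) (hW : finrank ℝ W = 2)
    (A : Set (Pt n)) (hA : IsLConvexConcave W A)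
    {ι : Type} (Nfam : ι → Submodule ℝ (Vec n))
    (hNW : ∀ i, W ≤ Nfam i) (hNdim : ∀ i, finrank ℝ (Nfam i) = 3)
    (φ g : ι → Module.Dual ℝ (Vec n))
    (hφW : ∀ i, ∀ w ∈ W, φ i w = 0)
    (hφker : ∀ i, ∀ v ∈ Nfam i, φ i v = 0 → v ∈ W)
    (hnonconst : ∀ i, ¬∃ c : ℝ, ∀ v ∈ Nfam i, g i v = c * φ i v)
    (hsupport : ∀ i, ∀ x ∈ A, x.rep ∈ Nfam i → 0 ≤ g i x.rep / φ i x.rep)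
    (htouch : ∀ i, ∃ x ∈ A, x.rep ∈ Nfam i ∧ g i x.rep = 0)
    (hfourpts : ∃ Q : Finset (Pt n), Q.card ≤ 4 ∧
      ∀ i, ∃ q ∈ Q, q.rep ∈ W ∧ g i q.rep = 0) :
    ∃ M : Submodule ℝ (Vec n), finrank ℝ M = n - 1 ∧
      ∀ i, ∃ x : Pt n, x.rep ∈ M ∧ x.rep ∈ Nfam i ∧ φ i x.rep ≠ 0 ∧
        0 ≤ g i x.rep / φ i x.rep := by
  classical
  obtain ⟨Q, hQc, hQ⟩ := hfourpts
  obtain ⟨X, Y, b₁, b₂, hb₁, hb₂, hX1, hY1, hX2, hY2, hrep, hYQ⟩ := coords_s17 W hW Q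
  obtain ⟨X', Y', hX'W, hY'W, hsel⟩ := selection W A hA X Y b₁ hb₁ hX1 hY1
    (Q.image fun q => -(X q.rep) / Y q.rep) (Finset.card_image_le.trans hQc)
  let P : Vec n →ₗ[ℝ] ℝ × ℝ := (X - X').prod (Y - Y')
  have hP : ∀ v, P v = (X v - X' v, Y v - Y' v) := fun v => rfl
  have hsurj : LinearMap.range P = ⊤ := by
    rw [LinearMap.range_eq_top]
    rintro ⟨a, c⟩
    refine ⟨a • b₁ + c • b₂, ?_⟩
    simp [hP, hX1, hY1, hX2, hY2, hX'W b₁ hb₁, hX'W b₂ hb₂, hY'W b₁ hb₁, hY'W b₂ hb₂]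
  refine ⟨LinearMap.ker P, ?_, ?_⟩
  · have h1 := P.finrank_range_add_finrank_ker
    rw [hsurj, finrank_top] at h1
    simp at h1
    omega
  intro i
  -- a vector of `N i` outside `W`
  obtain ⟨u, huN, huW⟩ : ∃ u ∈ Nfam i, u ∉ W := by
    by_contra hcon
    push Not at hcon
    have hle : Nfam i ≤ W := hcon
    have := Submodule.finrank_mono hle
    rw [hNdim, hW] at this
    omega
  have hφu : φ i u ≠ 0 := fun h => huW (hφker i u huN h)
  -- adjust so that it lies in the kernel of `P`
  set v := (φ i u)⁻¹ • (u - ((X u - X' u) • b₁ + (Y u - Y' u) • b₂)) with hv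
  have hcorr : (X u - X' u) • b₁ + (Y u - Y' u) • b₂ ∈ W :=
    W.add_mem (W.smul_mem _ hb₁) (W.smul_mem _ hb₂)
  have hvN : v ∈ Nfam i := (Nfam i).smul_mem _ ((Nfam i).sub_mem huN (hNW i hcorr))
  have hφv : φ i v = 1 := by
    rw [hv, map_smul, map_sub, hφW i _ hcorr, sub_zero, smul_eq_mul, inv_mul_cancel₀ hφu]
  have hvP : P v = 0 := by
    have : P (u - ((X u - X' u) • b₁ + (Y u - Y' u) • b₂)) = 0 := by
      simp [hP, hX1, hY1, hX2, hY2, hX'W b₁ hb₁, hX'W b₂ hb₂, hY'W b₁ hb₁, hY'W b₂ hb₂]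
    rw [hv, map_smul, this, smul_zero]
  have hXv : X v = X' v := by
    have := (Prod.ext_iff.1 hvP).1
    rw [hP] at this
    exact sub_eq_zero.1 this
  have hYv : Y v = Y' v := by
    have := (Prod.ext_iff.1 hvP).2
    rw [hP] at this
    exact sub_eq_zero.1 this
  have hv0 : v ≠ 0 := by
    intro h; rw [h, map_zero] at hφv; exact zero_ne_one hφv
  -- decomposition of `N i`
  have hdec : ∀ z ∈ Nfam i, z - φ i z • v ∈ W := by
    intro z hz
    apply hφker i _ ((Nfam i).sub_mem hz ((Nfam i).smul_mem _ hvN))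
    rw [map_sub, map_smul, hφv]; simp
  obtain ⟨q, hqQ, hqW, hgq⟩ := hQ i
  have hYq := hYQ q hqQ hqW
  set s := -(X q.rep) / Y q.rep with hs
  have hsel' := hsel s (Finset.mem_image.2 ⟨q, hqQ, rfl⟩)
  set c := g i b₁ with hc
  have hgb2 : g i b₂ = c * s := by
    have h1 := congrArg (g i) (hrep _ hqW)
    rw [hgq, map_add, map_smul, map_smul, smul_eq_mul, smul_eq_mul, ← hc] at h1
    rw [hs]
    field_simp
    linarith
  have hgW : ∀ w ∈ W, g i w = c * (X w + s * Y w) := by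
    intro w hw
    have h1 := congrArg (g i) (hrep w hw)
    rw [map_add, map_smul, map_smul, smul_eq_mul, smul_eq_mul, ← hc, hgb2] at h1
    rw [h1]; ring
  have hc0 : c ≠ 0 := by
    intro h0
    apply hnonconst i
    refine ⟨g i v, fun z hz => ?_⟩
    have h1 := hgW _ (hdec z hz)
    rw [h0, zero_mul, map_sub, map_smul, smul_eq_mul] at h1
    linarith
  -- every point of the section satisfies the inequality
  have hpt : ∀ w ∈ W, v + w ∈ coneOf A → 0 ≤ g i v + c * (X w + s * Y w) := by
    intro w hw hcw
    have h0 : v + w ≠ 0 := by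
      intro h
      have := congrArg (φ i) h
      rw [map_add, hφv, hφW i w hw, map_zero] at this
      norm_num at this
    obtain ⟨x, hx, a, ha, hxa⟩ := exists_rep_of_cone hcw h0
    have h1 := hsupport i x hx (hxa ▸ (Nfam i).smul_mem a ((Nfam i).add_mem hvN (hNW i hw)))
    rw [hxa, map_smul, map_smul, map_add, map_add, hφv, hφW i w hw, hgW w hw, smul_eq_mul,
      smul_eq_mul, add_zero, mul_one, mul_div_cancel_left₀ _ ha] at h1
    exact h1
  have hfinal : 0 ≤ g i v := by
    rcases lt_or_gt_of_ne hc0 with hneg | hpos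
    · have h1 := hsel' v (X v + s * Y v + g i v / (-c)) (by
        intro w hw hcw
        have h2 := hpt w hw hcw
        have h3 : X w + s * Y w ≤ g i v / (-c) := by
          rw [le_div_iff₀ (by linarith)]; linarith
        rw [map_add, map_add]; linarith)
      rw [← hXv, ← hYv] at h1
      have h4 : 0 ≤ g i v / (-c) := by linarith
      have h5 := mul_nonneg h4 (show (0 : ℝ) ≤ -c by linarith)
      rwa [div_mul_cancel₀ _ (by simpa using hc0)] at h5
    · have h1 := hsel' (-v) (-(X v + s * Y v) + g i v / c) (by
        intro w hw hcw
        have h2 := hpt (-w) (W.neg_mem hw) (by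
          have := coneOf_smul hcw (-1)
          convert this using 1
          module)
        rw [map_neg, map_neg] at h2
        have h3 : X w + s * Y w ≤ g i v / c := by
          rw [le_div_iff₀ hpos]; linarith
        rw [map_add, map_add, map_neg, map_neg]; linarith)
      rw [map_neg, map_neg, ← hXv, ← hYv] at h1
      have h4 : 0 ≤ g i v / c := by linarith
      have h5 := mul_nonneg h4 hpos.le
      rwa [div_mul_cancel₀ _ hc0] at h5
  clear_value v
  obtain ⟨a, ha⟩ := Projectivization.exists_smul_eq_mk_rep ℝ v hv0
  have ha' : (Projectivization.mk ℝ v hv0).rep = (a : ℝ) • v := ha.symm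
  have ha0 : (a : ℝ) ≠ 0 := a.ne_zero
  refine ⟨Projectivization.mk ℝ v hv0, ?_, ?_, ?_, ?_⟩
  · rw [ha', LinearMap.mem_ker, map_smul, hvP, smul_zero]
  · rw [ha']; exact (Nfam i).smul_mem _ hvN
  · rw [ha', map_smul, hφv]; simpa using ha0
  · rw [ha', map_smul, map_smul, hφv, smul_eq_mul, smul_eq_mul, mul_one,
      mul_div_cancel_left₀ _ ha0]
    exact hfinal

end CC
end
end
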